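/- arXiv:2107.14205 — 9 statements merged into one kernel-verified Lean document; each statement's English description precedes it below -/
import Mathlib

section
/- Let (A, ·, α) be a Hom-pre-Lie algebra over a field K of characteristic zero and (V, ρ, μ, β) a representation of A. If φ ∈ Hom(A^⊗n, V) satisfies the compatibility condition β ∘ φ = φ ∘ α^⊗n (equivalently ∂̃_{να}φ = 0), then ∂̃_{νν}φ satisfies β ∘ (∂̃_{νν}φ) = (∂̃_{νν}φ) ∘ α^⊗(n+1) (equivalently ∂̃_{να}(∂̃_{νν}φ) = 0). Hence the cochains compatible with the structure maps form a subcomplex of the α-type complex on which ∂̃_{νν} is a differential. -/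
open Finset

structure HomPreLieStr (K A : Type) [Field K] [AddCommGroup A] [Module K A] where
  mul : A →ₗ[K] A →ₗ[K] A
  alpha : A →ₗ[K] A
  homPreLie : ∀ a b c : A,
    mul (mul a b) (alpha c) - mul (alpha a) (mul b c)
      = mul (mul b a) (alpha c) - mul (alpha b) (mul a c)
  alpha_mult : ∀ a b : A, alpha (mul a b) = mul (alpha a) (alpha b)

/-- A representation `(V, ρ, μ, β)` of a Hom-pre-Lie algebra. -/
structure HomPreLieRep {K A : Type} [Field K] [AddCommGroup A] [Module K A]
    (S : HomPreLieStr K A) (V : Type) [AddCommGroup V] [Module K V] where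
  rho : A →ₗ[K] (V →ₗ[K] V)
  mu : A →ₗ[K] (V →ₗ[K] V)
  beta : V →ₗ[K] V
  rho_alpha : ∀ (a : A) (v : V), rho (S.alpha a) (beta v) = beta (rho a v)
  rho_brkt : ∀ (a b : A) (v : V),
    rho (S.mul a b - S.mul b a) (beta v)
      = rho (S.alpha a) (rho b v) - rho (S.alpha b) (rho a v)
  beta_mu : ∀ (a : A) (v : V), beta (mu a v) = mu (S.alpha a) (beta v)
  mu_cond : ∀ (a b : A) (v : V),
    mu (S.alpha b) (mu a v) - mu (S.mul a b) (beta v)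
      = mu (S.alpha b) (rho a v) - rho (S.alpha a) (mu b v)

section Differentials

variable {A V : Type} [AddCommGroup A] [AddCommGroup V]

/-- `∂̃_{νν}` : takes an `(n+1)`-cochain to an `(n+2)`-cochain. -/
def dnn (mul : A → A → A) (alpha : A → A) (rho mu : A → V → V)
    (n : ℕ) (f : (Fin (n + 1) → A) → V) (a : Fin (n + 2) → A) : V :=
  (∑ i : Fin (n + 1), (-1 : ℤ) ^ (i : ℕ) •
      rho (alpha^[n] (a i.castSucc)) (f (fun j => a (i.castSucc.succAbove j))))
  + (∑ i : Fin (n + 1), (-1 : ℤ) ^ (i : ℕ) •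
      mu (alpha^[n] (a (Fin.last (n + 1))))
        (f (Fin.snoc (fun j : Fin n => a ((i.succAbove j).castSucc)) (a i.castSucc))))
  - (∑ i : Fin (n + 1), (-1 : ℤ) ^ (i : ℕ) •
      f (Fin.snoc (fun j : Fin n => alpha (a ((i.succAbove j).castSucc)))
          (mul (a i.castSucc) (a (Fin.last (n + 1))))))
  + (∑ i : Fin (n + 1), ∑ j : Fin (n + 1), if (i : ℕ) < (j : ℕ) then
      (-1 : ℤ) ^ ((i : ℕ) + (j : ℕ)) •
        f (Fin.cons
            (mul (a i.castSucc) (a j.castSucc) - mul (a j.castSucc) (a i.castSucc))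
            (fun k : Fin n => alpha (a (j.castSucc.succAbove (i.succAbove k)))))
      else 0)

/-- `∂̃_{αα}` : takes a `(p+1)`-cochain (the `α`-part of a degree-`(p+2)` cochain)
to a `(p+2)`-cochain. -/
def daa (mul : A → A → A) (alpha : A → A) (rho mu : A → V → V)
    (p : ℕ) (g : (Fin (p + 1) → A) → V) (a : Fin (p + 2) → A) : V :=
  (∑ i : Fin (p + 2), (-1 : ℤ) ^ (i : ℕ) •
      rho (alpha^[p + 1] (a i)) (g (fun j => a (i.succAbove j))))
  + (∑ i : Fin (p + 1), (-1 : ℤ) ^ (i : ℕ) •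
      mu (alpha^[p + 1] (a (Fin.last (p + 1))))
        (g (Fin.snoc (fun j : Fin p => a ((i.succAbove j).castSucc)) (a i.castSucc))))
  - (∑ i : Fin (p + 1), (-1 : ℤ) ^ (i : ℕ) •
      g (Fin.snoc (fun j : Fin p => alpha (a ((i.succAbove j).castSucc)))
          (mul (a i.castSucc) (a (Fin.last (p + 1))))))
  + (∑ i : Fin (p + 1), ∑ j : Fin (p + 1), if (i : ℕ) < (j : ℕ) then
      (-1 : ℤ) ^ ((i : ℕ) + (j : ℕ)) •
        g (Fin.cons
            (mul (a i.castSucc) (a j.castSucc) - mul (a j.castSucc) (a i.castSucc))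
            (fun k : Fin p => alpha (a (j.castSucc.succAbove (i.succAbove k)))))
      else 0)

/-- `∂̃_{να}` : `β ∘ f − f ∘ α^⊗n`. -/
def dna (alpha : A → A) (beta : V → V) {n : ℕ}
    (f : (Fin n → A) → V) (a : Fin n → A) : V :=
  beta (f a) - f (fun i => alpha (a i))

/-- `∂̃_{αν}` : takes an `(m+1)`-cochain (the `α`-part of a degree-`(m+2)` cochain)
to an `(m+3)`-cochain. -/
def dan (mul : A → A → A) (alpha : A → A) (rho mu : A → V → V)
    (m : ℕ) (g : (Fin (m + 1) → A) → V) (a : Fin (m + 3) → A) : V :=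
  (∑ i : Fin (m + 2), (-1 : ℤ) ^ (i : ℕ) •
      mu (alpha^[m] (mul (a i.castSucc) (a (Fin.last (m + 2)))))
        (g (fun j : Fin (m + 1) => a ((i.succAbove j).castSucc))))
  - (∑ i : Fin (m + 2), ∑ j : Fin (m + 2), if (i : ℕ) < (j : ℕ) then
      (-1 : ℤ) ^ ((i : ℕ) + (j : ℕ)) •
        rho (mul (alpha^[m] (a i.castSucc)) (alpha^[m] (a j.castSucc))
              - mul (alpha^[m] (a j.castSucc)) (alpha^[m] (a i.castSucc)))
          (g (fun k : Fin (m + 1) => a (j.castSucc.succAbove (i.succAbove k))))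
      else 0)

end Differentials

/-- If a multilinear cochain `φ : A^⊗n → V` (here `n = m+1`) is compatible with the
structure maps, i.e. `β ∘ φ = φ ∘ α^⊗n` (equivalently `∂̃_{να}φ = 0`), then so is
`∂̃_{νν}φ` : `β ∘ (∂̃_{νν}φ) = (∂̃_{νν}φ) ∘ α^⊗(n+1)` (equivalently
`∂̃_{να}(∂̃_{νν}φ) = 0`).  Hence the compatible cochains form a subcomplex on which
`∂̃_{νν}` is a differential. -/
theorem compatible_subcomplex (K A V : Type) [Field K] [CharZero K]
    [AddCommGroup A] [Module K A] [AddCommGroup V] [Module K V]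
    (S : HomPreLieStr K A) (R : HomPreLieRep S V) (m : ℕ)
    (φ : MultilinearMap K (fun _ : Fin (m + 1) => A) V)
    (hφ : ∀ a : Fin (m + 1) → A, R.beta (φ a) = φ (fun i => S.alpha (a i))) :
    ∀ a : Fin (m + 2) → A,
      R.beta (dnn (fun a b => S.mul a b) (⇑S.alpha)
          (fun a v => R.rho a v) (fun a v => R.mu a v) m ⇑φ a)
        = dnn (fun a b => S.mul a b) (⇑S.alpha)
            (fun a v => R.rho a v) (fun a v => R.mu a v) m ⇑φ
            (fun i => S.alpha (a i)) := by
  intro a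
  have snoc_comp (g : Fin m → A) (x : A) :
      (fun i => S.alpha (Fin.snoc (α := fun _ => A) g x i))
        = Fin.snoc (α := fun _ => A) (fun j => S.alpha (g j)) (S.alpha x) :=
    Fin.comp_snoc S.alpha g x
  have cons_comp (g : Fin m → A) (x : A) :
      (fun i => S.alpha (Fin.cons (α := fun _ => A) x g i))
        = Fin.cons (α := fun _ => A) (S.alpha x) (fun j => S.alpha (g j)) :=
    Fin.comp_cons S.alpha x g
  have alpha_iterate (x : A) : S.alpha^[m] (S.alpha x) = S.alpha (S.alpha^[m] x) :=
    Function.Commute.iterate_self S.alpha m x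
  simp only [dnn, map_add, map_sub, map_sum, map_zsmul, apply_ite R.beta, map_zero,
    ← R.rho_alpha, R.beta_mu, hφ, snoc_comp, cons_comp, S.alpha_mult, alpha_iterate]
end

section
/- Let (A, ·, α) be a Hom-pre-Lie algebra over a field K of characteristic zero, and let (ν_i, α_i)_{i≥0} be a formal deformation of A. Suppose n ≥ 1 is such that ν_i = 0 and α_i = 0 for all 1 ≤ i < n (so (ν_n, α_n) is the n-th infinitesimal of the deformation). Then (ν_n, α_n) is a 2-cocycle of the α-type cohomology of A with coefficients in the regular representation: ∂̃_{νν}ν_n − ∂̃_{αν}α_n = 0 and ∂̃_{να}ν_n − ∂̃_{αα}α_n = 0. -/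
open Finset

section LowDiff

variable {K A : Type} [Field K] [AddCommGroup A] [Module K A]

/-- `∂̃_{νν}` of a bilinear 2-cochain (regular coefficients). -/
def Dnn2 (S : HomPreLieStr K A) (f : A →ₗ[K] A →ₗ[K] A) (a b c : A) : A :=
  S.mul (S.alpha a) (f b c) - S.mul (S.alpha b) (f a c)
    + S.mul (f b a) (S.alpha c) - S.mul (f a b) (S.alpha c)
    - f (S.alpha b) (S.mul a c) + f (S.alpha a) (S.mul b c)
    - f (S.mul a b) (S.alpha c) + f (S.mul b a) (S.alpha c)

/-- `∂̃_{αν}` of a linear 1-cochain (regular coefficients). -/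
def Dan2 (S : HomPreLieStr K A) (g : A →ₗ[K] A) (a b c : A) : A :=
  S.mul (g b) (S.mul a c) - S.mul (g a) (S.mul b c)
    + S.mul (S.mul a b) (g c) - S.mul (S.mul b a) (g c)

/-- `∂̃_{να}` of a bilinear 2-cochain (regular coefficients). -/
def Dna2 (S : HomPreLieStr K A) (f : A →ₗ[K] A →ₗ[K] A) (a b : A) : A :=
  S.alpha (f a b) - f (S.alpha a) (S.alpha b)

/-- `∂̃_{αα}` of a linear 1-cochain (regular coefficients). -/
def Daa2 (S : HomPreLieStr K A) (g : A →ₗ[K] A) (a b : A) : A :=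
  S.mul (S.alpha a) (g b) + S.mul (g a) (S.alpha b) - g (S.mul a b)

/-- `∂̃_{νν}` of a linear 1-cochain (regular coefficients). -/
def Dnn1 (S : HomPreLieStr K A) (g : A →ₗ[K] A) (a b : A) : A :=
  S.mul a (g b) + S.mul (g a) b - g (S.mul a b)

/-- `∂̃_{να}` of a linear 1-cochain (regular coefficients). -/
def Dna1 (S : HomPreLieStr K A) (g : A →ₗ[K] A) (a : A) : A :=
  S.alpha (g a) - g (S.alpha a)

end LowDiff

/-- A one-parameter formal deformation `(ν_t, α_t)` of a Hom-pre-Lie algebra,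
given by the coefficient sequences `ν_i` (bilinear) and `α_i` (linear), with
`ν₀ = ·`, `α₀ = α`, satisfying the deformation equations in each order `n`. -/
structure FormalDef {K A : Type} [Field K] [AddCommGroup A] [Module K A]
    (S : HomPreLieStr K A) where
  nu : ℕ → (A →ₗ[K] A →ₗ[K] A)
  al : ℕ → (A →ₗ[K] A)
  nu_zero : ∀ a b : A, nu 0 a b = S.mul a b
  al_zero : ∀ a : A, al 0 a = S.alpha a
  deform : ∀ (n : ℕ) (a b c : A),
    (∑ i ∈ Finset.range (n + 1), ∑ j ∈ Finset.range (n + 1 - i),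
      (nu i (nu j a b) (al (n - i - j) c) - nu i (al j a) (nu (n - i - j) b c)
        - nu i (nu j b a) (al (n - i - j) c) + nu i (al j b) (nu (n - i - j) a c))) = 0
  deform_alpha : ∀ (n : ℕ) (a b : A),
    (∑ i ∈ Finset.range (n + 1), ∑ j ∈ Finset.range (n + 1 - i),
      nu i (al j a) (al (n - i - j) b))
      = ∑ i ∈ Finset.range (n + 1), al i (nu (n - i) a b)

/-- A deformation of order `n` of a Hom-pre-Lie algebra: the deformation
equations hold in all orders `m ≤ n`. -/
def IsDefOrder {K A : Type} [Field K] [AddCommGroup A] [Module K A]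
    (S : HomPreLieStr K A) (nu : ℕ → (A →ₗ[K] A →ₗ[K] A))
    (al : ℕ → (A →ₗ[K] A)) (n : ℕ) : Prop :=
  (∀ a b : A, nu 0 a b = S.mul a b) ∧ (∀ a : A, al 0 a = S.alpha a) ∧
  (∀ m ≤ n, ∀ a b c : A,
    (∑ i ∈ Finset.range (m + 1), ∑ j ∈ Finset.range (m + 1 - i),
      (nu i (nu j a b) (al (m - i - j) c) - nu i (al j a) (nu (m - i - j) b c)
        - nu i (nu j b a) (al (m - i - j) c) + nu i (al j b) (nu (m - i - j) a c))) = 0) ∧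
  (∀ m ≤ n, ∀ a b : A,
    (∑ i ∈ Finset.range (m + 1), ∑ j ∈ Finset.range (m + 1 - i),
      nu i (al j a) (al (m - i - j) b))
      = ∑ i ∈ Finset.range (m + 1), al i (nu (m - i) a b))

/-- The `ν`-component `Oⁿ_ν` of the obstruction of an order-`n` deformation:
the sum over `i+j+k = n+1` with `0 ≤ i,j,k ≤ n` of the associator terms. -/
def obsNu {K A : Type} [Field K] [AddCommGroup A] [Module K A]
    (nu : ℕ → (A →ₗ[K] A →ₗ[K] A)) (al : ℕ → (A →ₗ[K] A))
    (n : ℕ) (a b c : A) : A :=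
  ∑ i ∈ Finset.range (n + 1), ∑ j ∈ Finset.range (n + 1),
    if i + j ≤ n + 1 ∧ n + 1 - i - j ≤ n then
      (nu i (nu j a b) (al (n + 1 - i - j) c)
        - nu i (al (n + 1 - i - j) a) (nu j b c)
        - nu i (nu j b a) (al (n + 1 - i - j) c)
        + nu i (al (n + 1 - i - j) b) (nu j a c))
    else 0

/-- The `α`-component `Oⁿ_α` of the obstruction of an order-`n` deformation. -/
def obsAl {K A : Type} [Field K] [AddCommGroup A] [Module K A]
    (nu : ℕ → (A →ₗ[K] A →ₗ[K] A)) (al : ℕ → (A →ₗ[K] A))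
    (n : ℕ) (a b : A) : A :=
  (∑ i ∈ Finset.range (n + 1), ∑ j ∈ Finset.range (n + 1),
    if i + j ≤ n + 1 ∧ n + 1 - i - j ≤ n then
      nu i (al j a) (al (n + 1 - i - j) b)
    else 0)
  - ∑ i ∈ Finset.Icc 1 n, al i (nu (n + 1 - i) a b)

/-- Equivalence of two formal deformations via a formal isomorphism
`Ψ_t = Σ ψ_i t^i` with `ψ₀ = id`:
`Ψ_t ∘ ν'_t = ν_t ∘ (Ψ_t ⊗ Ψ_t)` and `α_t ∘ Ψ_t = Ψ_t ∘ α'_t`. -/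
def AreEquiv {K A : Type} [Field K] [AddCommGroup A] [Module K A]
    {S : HomPreLieStr K A} (D D' : FormalDef S) (ψ : ℕ → (A →ₗ[K] A)) : Prop :=
  (∀ a : A, ψ 0 a = a) ∧
  (∀ (n : ℕ) (a b : A),
    (∑ i ∈ Finset.range (n + 1), ψ i (D'.nu (n - i) a b))
      = ∑ i ∈ Finset.range (n + 1), ∑ j ∈ Finset.range (n + 1 - i),
          D.nu i (ψ j a) (ψ (n - i - j) b)) ∧
  (∀ (n : ℕ) (a : A),
    (∑ i ∈ Finset.range (n + 1), D.al i (ψ (n - i) a))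
      = ∑ i ∈ Finset.range (n + 1), ψ i (D'.al (n - i) a))

/-- A sum over `range (n + 1)` whose terms strictly between `0` and `n` vanish reduces to its
two extreme terms. -/
theorem sum_range_succ_eq_zero_add_self {M : Type*} [AddCommMonoid M] (f : ℕ → M) {n : ℕ}
    (hn : 1 ≤ n) (h : ∀ i, 1 ≤ i → i < n → f i = 0) :
    ∑ i ∈ Finset.range (n + 1), f i = f 0 + f n := by
  obtain ⟨m, rfl⟩ := Nat.exists_eq_add_of_le' hn
  rw [Finset.sum_range_succ, Finset.sum_range_succ', Finset.sum_eq_zero, zero_add]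
  intro i hi
  exact h (i + 1) (by omega) (by simpa using hi)

/-- A sum over the triples `i + j + k = n` reduces to its three corner terms when the terms with
`0 < i < n`, and those with `i = 0` and `0 < j < n`, vanish. -/
theorem sum_range_triple_eq_corners {M : Type*} [AddCommMonoid M] (f : ℕ → ℕ → ℕ → M) {n : ℕ}
    (hn : 1 ≤ n) (hi : ∀ i j k, 1 ≤ i → i < n → f i j k = 0)
    (hj : ∀ j k, 1 ≤ j → j < n → f 0 j k = 0) :
    ∑ i ∈ Finset.range (n + 1), ∑ j ∈ Finset.range (n + 1 - i), f i j (n - i - j)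
      = f 0 0 n + f 0 n 0 + f n 0 0 := by
  rw [sum_range_succ_eq_zero_add_self _ hn
    fun i h1 h2 => Finset.sum_eq_zero fun j _ => hi i j _ h1 h2]
  simp only [Nat.sub_zero]
  rw [sum_range_succ_eq_zero_add_self _ hn fun j h1 h2 => hj j _ h1 h2]
  simp

/-- The `n`-th infinitesimal `(ν_n, α_n)` of a formal deformation (the first
possibly non-zero term after `(ν₀, α₀)`) is a 2-cocycle of the α-type cohomology:
`∂̃_{νν}ν_n − ∂̃_{αν}α_n = 0` and `∂̃_{να}ν_n − ∂̃_{αα}α_n = 0`. -/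
theorem infinitesimal_is_cocycle (K A : Type) [Field K] [CharZero K]
    [AddCommGroup A] [Module K A] (S : HomPreLieStr K A)
    (D : FormalDef S) (n : ℕ) (hn : 1 ≤ n)
    (hvanish : ∀ i, 1 ≤ i → i < n → (∀ a b : A, D.nu i a b = 0) ∧ (∀ a : A, D.al i a = 0)) :
    (∀ a b c : A, Dnn2 S (D.nu n) a b c - Dan2 S (D.al n) a b c = 0) ∧
    (∀ a b : A, Dna2 S (D.nu n) a b - Daa2 S (D.al n) a b = 0) := by
  have hnu i (h1 : 1 ≤ i) (h2 : i < n) : D.nu i = 0 :=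
    LinearMap.ext₂ (hvanish i h1 h2).1
  have hal i (h1 : 1 ≤ i) (h2 : i < n) : D.al i = 0 :=
    LinearMap.ext (hvanish i h1 h2).2
  refine ⟨fun a b c => ?_, fun a b => ?_⟩
  · have h := D.deform n a b c
    rw [sum_range_triple_eq_corners (fun i j k =>
        D.nu i (D.nu j a b) (D.al k c) - D.nu i (D.al j a) (D.nu k b c)
          - D.nu i (D.nu j b a) (D.al k c) + D.nu i (D.al j b) (D.nu k a c)) hn
      (fun i j k h1 h2 => by simp [hnu i h1 h2])
      (fun j k h1 h2 => by simp [hnu j h1 h2, hal j h1 h2])] at h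
    simp only [D.nu_zero, D.al_zero] at h
    rw [← neg_eq_zero, ← h, Dnn2, Dan2]
    abel
  · have h := D.deform_alpha n a b
    rw [sum_range_triple_eq_corners (fun i j k => D.nu i (D.al j a) (D.al k b)) hn
      (fun i j k h1 h2 => by simp [hnu i h1 h2])
      (fun j k h1 h2 => by simp [hal j h1 h2]),
      sum_range_succ_eq_zero_add_self _ hn fun i h1 h2 => by simp [hal i h1 h2]] at h
    simp only [D.nu_zero, D.al_zero, Nat.sub_zero, Nat.sub_self] at h
    rw [← sub_eq_zero_of_eq h.symm, Dna2, Daa2]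
    abel
end

section
/- Let (A, ·, α) be a Hom-pre-Lie algebra over a field K of characteristic zero, and let (ν_i, α_i)_{0≤i≤n} be a deformation of A of order n with obstruction Oⁿ = (Oⁿ_ν, Oⁿ_α). Then the deformation extends to a deformation of order n+1 (i.e., there exist a bilinear map ν_{n+1} : A×A→A and a linear map α_{n+1} : A→A such that (ν_i, α_i)_{0≤i≤n+1} is an order-(n+1) deformation) if and only if Oⁿ is a 2-coboundary, i.e., there exist a bilinear map ν' : A×A→A and a linear map α' : A→A with Oⁿ_ν = ∂̃_{νν}ν' − ∂̃_{αν}α' and Oⁿ_α = ∂̃_{να}ν' − ∂̃_{αα}α'. -/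
open Finset

section TripleSums

variable {M : Type*} [AddCommGroup M]

/-- A sum over `i + j + k = n + 1` splits into its three corner terms and the terms with
`i, j, k ≤ n`. -/
theorem sum_triples_succ_eq (F : ℕ → ℕ → ℕ → M) (n : ℕ) :
    (∑ i ∈ range (n + 1 + 1), ∑ j ∈ range (n + 1 + 1 - i), F i j (n + 1 - i - j))
      = F (n + 1) 0 0 + F 0 (n + 1) 0 + F 0 0 (n + 1)
        + ∑ i ∈ range (n + 1), ∑ j ∈ range (n + 1),
            if i + j ≤ n + 1 ∧ n + 1 - i - j ≤ n then F i j (n + 1 - i - j) else 0 := by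
  have key : ∀ i ∈ range (n + 1), (∑ j ∈ range (n + 1 + 1 - i), F i j (n + 1 - i - j))
      = (∑ j ∈ range (n + 1),
          if i + j ≤ n + 1 ∧ n + 1 - i - j ≤ n then F i j (n + 1 - i - j) else 0)
        + if i = 0 then F 0 (n + 1) 0 + F 0 0 (n + 1) else 0 := by
    intro i hi
    have hi' := mem_range.mp hi
    rcases i with _ | i
    · rw [Nat.sub_zero, sum_range_succ, sum_range_succ', sum_range_succ' _ n]
      have : ∀ j ∈ range n, F 0 (j + 1) (n + 1 - 0 - (j + 1))
          = if 0 + (j + 1) ≤ n + 1 ∧ n + 1 - 0 - (j + 1) ≤ n then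
              F 0 (j + 1) (n + 1 - 0 - (j + 1)) else 0 := by
        intro j hj
        have := mem_range.mp hj
        rw [if_pos (by omega)]
      rw [sum_congr rfl this]
      simp
      abel
    · rw [if_neg (by omega), add_zero]
      refine sum_subset_zero_on_sdiff (range_subset_range.mpr (by omega)) ?_ ?_
      · intro j hj
        have := mt mem_range.mpr (mem_sdiff.mp hj).2
        rw [if_neg (by omega)]
      · intro j hj
        have := mem_range.mp hj
        rw [if_pos (by omega)]
  rw [sum_range_succ, sum_congr rfl key, sum_add_distrib]
  simp
  abel

/-- A sum over `i + j + k = m` is unchanged when `j` and `k` are exchanged. -/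
theorem sum_triples_swap (F : ℕ → ℕ → ℕ → M) (m : ℕ) :
    (∑ i ∈ range (m + 1), ∑ j ∈ range (m + 1 - i), F i j (m - i - j))
      = ∑ i ∈ range (m + 1), ∑ j ∈ range (m + 1 - i), F i (m - i - j) j := by
  refine sum_congr rfl fun i hi => ?_
  have := mem_range.mp hi
  rw [← sum_range_reflect]
  refine sum_congr rfl fun j hj => ?_
  have := mem_range.mp hj
  congr 1 <;> omega

end TripleSums

section Extension

variable {K A : Type} [Field K] [AddCommGroup A] [Module K A]

theorem obsNu_update (nu : ℕ → (A →ₗ[K] A →ₗ[K] A)) (al : ℕ → (A →ₗ[K] A)) (n : ℕ)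
    (nu1 : A →ₗ[K] A →ₗ[K] A) (al1 : A →ₗ[K] A) (a b c : A) :
    obsNu (Function.update nu (n + 1) nu1) (Function.update al (n + 1) al1) n a b c
      = obsNu nu al n a b c := by
  refine sum_congr rfl fun i hi => sum_congr rfl fun j hj => ?_
  have hi' := mem_range.mp hi
  have hj' := mem_range.mp hj
  split_ifs with hk
  · rw [Function.update_of_ne (by omega), Function.update_of_ne (by omega),
      Function.update_of_ne (by omega)]
  · rfl

theorem obsAl_update (nu : ℕ → (A →ₗ[K] A →ₗ[K] A)) (al : ℕ → (A →ₗ[K] A)) (n : ℕ)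
    (nu1 : A →ₗ[K] A →ₗ[K] A) (al1 : A →ₗ[K] A) (a b : A) :
    obsAl (Function.update nu (n + 1) nu1) (Function.update al (n + 1) al1) n a b
      = obsAl nu al n a b := by
  refine congrArg₂ (· - ·)
    (sum_congr rfl fun i hi => sum_congr rfl fun j hj => ?_) (sum_congr rfl fun i hi => ?_)
  · have hi' := mem_range.mp hi
    have hj' := mem_range.mp hj
    split_ifs with hk
    · rw [Function.update_of_ne (by omega), Function.update_of_ne (by omega),
        Function.update_of_ne (by omega)]
    · rfl
  · have := mem_Icc.mp hi
    rw [Function.update_of_ne (by omega), Function.update_of_ne (by omega)]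

/-- The order `n + 1` Hom-pre-Lie expression is the obstruction minus the coboundary of the
top coefficients. -/
theorem sum_deform_succ_eq (S : HomPreLieStr K A) (nu : ℕ → (A →ₗ[K] A →ₗ[K] A))
    (al : ℕ → (A →ₗ[K] A)) (hnu : ∀ a b : A, nu 0 a b = S.mul a b)
    (hal : ∀ a : A, al 0 a = S.alpha a) (n : ℕ) (a b c : A) :
    (∑ i ∈ range (n + 1 + 1), ∑ j ∈ range (n + 1 + 1 - i),
      (nu i (nu j a b) (al (n + 1 - i - j) c) - nu i (al j a) (nu (n + 1 - i - j) b c)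
        - nu i (nu j b a) (al (n + 1 - i - j) c) + nu i (al j b) (nu (n + 1 - i - j) a c)))
      = obsNu nu al n a b c
        - (Dnn2 S (nu (n + 1)) a b c - Dan2 S (al (n + 1)) a b c) := by
  have hswap : ∀ x y z : A, (∑ i ∈ range (n + 1 + 1), ∑ j ∈ range (n + 1 + 1 - i),
      nu i (al j x) (nu (n + 1 - i - j) y z))
      = ∑ i ∈ range (n + 1 + 1), ∑ j ∈ range (n + 1 + 1 - i),
        nu i (al (n + 1 - i - j) x) (nu j y z) := fun x y z =>
    sum_triples_swap (fun i j k => nu i (al j x) (nu k y z)) (n + 1)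
  have hsum := sum_triples_succ_eq (fun i j k => nu i (nu j a b) (al k c)
    - nu i (al k a) (nu j b c) - nu i (nu j b a) (al k c) + nu i (al k b) (nu j a c)) n
  simp only [sum_add_distrib, sum_sub_distrib] at hsum ⊢
  rw [hswap, hswap, hsum]
  simp only [obsNu, Dnn2, Dan2, hnu, hal]
  abel

/-- The order `n + 1` multiplicativity defect is the obstruction minus the coboundary of the
top coefficients. -/
theorem sum_deform_alpha_succ_eq (S : HomPreLieStr K A) (nu : ℕ → (A →ₗ[K] A →ₗ[K] A))
    (al : ℕ → (A →ₗ[K] A)) (hnu : ∀ a b : A, nu 0 a b = S.mul a b)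
    (hal : ∀ a : A, al 0 a = S.alpha a) (n : ℕ) (a b : A) :
    (∑ i ∈ range (n + 1 + 1), ∑ j ∈ range (n + 1 + 1 - i),
      nu i (al j a) (al (n + 1 - i - j) b))
      - ∑ i ∈ range (n + 1 + 1), al i (nu (n + 1 - i) a b)
      = obsAl nu al n a b - (Dna2 S (nu (n + 1)) a b - Daa2 S (al (n + 1)) a b) := by
  have hIcc : ∑ i ∈ Icc 1 n, al i (nu (n + 1 - i) a b)
      = ∑ i ∈ range n, al (i + 1) (nu (n + 1 - (i + 1)) a b) := by
    rw [range_eq_Ico, sum_Ico_add' (fun i => al i (nu (n + 1 - i) a b)) 0 n 1]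
    rfl
  have hsum : ∑ i ∈ range (n + 1 + 1), al i (nu (n + 1 - i) a b)
      = ∑ i ∈ Icc 1 n, al i (nu (n + 1 - i) a b) + al 0 (nu (n + 1) a b)
        + al (n + 1) (nu 0 a b) := by
    rw [sum_range_succ, sum_range_succ', ← hIcc, Nat.sub_zero, Nat.sub_self]
  rw [sum_triples_succ_eq (fun i j k => nu i (al j a) (al k b)), hsum]
  simp only [obsAl, Dna2, Daa2, hnu, hal]
  abel

/-- Adding top coefficients to an order-`n` deformation gives an order-`(n+1)` deformation
exactly when the obstruction is their coboundary. -/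
theorem isDefOrder_update_iff (S : HomPreLieStr K A) {nu : ℕ → (A →ₗ[K] A →ₗ[K] A)}
    {al : ℕ → (A →ₗ[K] A)} {n : ℕ} (h : IsDefOrder S nu al n)
    (nu1 : A →ₗ[K] A →ₗ[K] A) (al1 : A →ₗ[K] A) :
    IsDefOrder S (Function.update nu (n + 1) nu1) (Function.update al (n + 1) al1) (n + 1)
      ↔ (∀ a b c : A, obsNu nu al n a b c = Dnn2 S nu1 a b c - Dan2 S al1 a b c) ∧
        (∀ a b : A, obsAl nu al n a b = Dna2 S nu1 a b - Daa2 S al1 a b) := by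
  obtain ⟨h0, h0', h1, h2⟩ := h
  have hnu : ∀ a b : A, Function.update nu (n + 1) nu1 0 a b = S.mul a b := by
    simpa [Function.update_of_ne] using h0
  have hal : ∀ a : A, Function.update al (n + 1) al1 0 a = S.alpha a := by
    simpa [Function.update_of_ne] using h0'
  have eN := sum_deform_succ_eq S _ _ hnu hal n
  have eA := sum_deform_alpha_succ_eq S _ _ hnu hal n
  simp only [obsNu_update, obsAl_update, Function.update_self] at eN eA
  constructor
  · rintro ⟨-, -, H1, H2⟩
    exact ⟨fun a b c => sub_eq_zero.mp ((eN a b c).symm.trans (H1 _ le_rfl a b c)),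
      fun a b => sub_eq_zero.mp ((eA a b).symm.trans (sub_eq_zero.mpr (H2 _ le_rfl a b)))⟩
  · rintro ⟨H1, H2⟩
    refine ⟨hnu, hal, fun m hm a b c => ?_, fun m hm a b => ?_⟩
    · rcases hm.eq_or_lt with rfl | hm
      · exact (eN a b c).trans (sub_eq_zero.mpr (H1 a b c))
      · rw [← h1 m (by omega) a b c]
        refine sum_congr rfl fun i hi => sum_congr rfl fun j hj => ?_
        have := mem_range.mp hi
        have := mem_range.mp hj
        simp only [Function.update_of_ne (show i ≠ n + 1 by omega),
          Function.update_of_ne (show j ≠ n + 1 by omega),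
          Function.update_of_ne (show m - i - j ≠ n + 1 by omega)]
    · rcases hm.eq_or_lt with rfl | hm
      · exact sub_eq_zero.mp ((eA a b).trans (sub_eq_zero.mpr (H2 a b)))
      · convert h2 m (by omega) a b using 1
        · refine sum_congr rfl fun i hi => sum_congr rfl fun j hj => ?_
          have := mem_range.mp hi
          have := mem_range.mp hj
          simp only [Function.update_of_ne (show i ≠ n + 1 by omega),
            Function.update_of_ne (show j ≠ n + 1 by omega),
            Function.update_of_ne (show m - i - j ≠ n + 1 by omega)]
        · refine sum_congr rfl fun i hi => ?_
          have := mem_range.mp hi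
          simp only [Function.update_of_ne (show i ≠ n + 1 by omega),
            Function.update_of_ne (show m - i ≠ n + 1 by omega)]

end Extension

/-- An order-`n` deformation of a Hom-pre-Lie algebra extends to an order-`(n+1)`
deformation if and only if its obstruction `Oⁿ = (Oⁿ_ν, Oⁿ_α)` is a 2-coboundary
of the α-type complex (with regular coefficients). -/
theorem extendable_iff_obstruction_coboundary (K A : Type) [Field K] [CharZero K]
    [AddCommGroup A] [Module K A] (S : HomPreLieStr K A)
    (nu : ℕ → (A →ₗ[K] A →ₗ[K] A)) (al : ℕ → (A →ₗ[K] A)) (n : ℕ)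
    (h : IsDefOrder S nu al n) :
    (∃ (nu1 : A →ₗ[K] A →ₗ[K] A) (al1 : A →ₗ[K] A),
        IsDefOrder S (Function.update nu (n + 1) nu1)
          (Function.update al (n + 1) al1) (n + 1))
    ↔
    (∃ (ν' : A →ₗ[K] A →ₗ[K] A) (α' : A →ₗ[K] A),
        (∀ a b c : A, obsNu nu al n a b c = Dnn2 S ν' a b c - Dan2 S α' a b c) ∧
        (∀ a b : A, obsAl nu al n a b = Dna2 S ν' a b - Daa2 S α' a b)) :=
  exists₂_congr fun nu1 al1 => isDefOrder_update_iff S h nu1 al1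
end

section
/- Let (A, ·, α) be a Hom-pre-Lie algebra over a field K of characteristic zero, and let (ν_i, α_i)_{i≥0} and (ν'_i, α'_i)_{i≥0} be two equivalent formal deformations of A, with equivalence given by (ψ_i)_{i≥0}, ψ₀ = id. Then their infinitesimals are cohomologous: for all a, b ∈ A, ν'₁(a,b) − ν₁(a,b) = a·ψ₁(b) + ψ₁(a)·b − ψ₁(a·b) = (∂̃_{νν}ψ₁)(a,b) and α'₁(a) − α₁(a) = α(ψ₁(a)) − ψ₁(α(a)) = (∂̃_{να}ψ₁)(a); that is, (ν'₁, α'₁) − (ν₁, α₁) = ∂̃(ψ₁, 0). -/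
open Finset

/-- Two equivalent formal deformations have cohomologous infinitesimals:
`ν'₁ − ν₁ = ∂̃_{νν}ψ₁` and `α'₁ − α₁ = ∂̃_{να}ψ₁`, i.e.
`(ν'₁, α'₁) − (ν₁, α₁) = ∂̃(ψ₁, 0)`. -/
theorem equivalent_infinitesimals_cohomologous (K A : Type) [Field K] [CharZero K]
    [AddCommGroup A] [Module K A] (S : HomPreLieStr K A)
    (D D' : FormalDef S) (ψ : ℕ → (A →ₗ[K] A)) (h : AreEquiv D D' ψ) :
    (∀ a b : A,
        D'.nu 1 a b - D.nu 1 a b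
          = S.mul a (ψ 1 b) + S.mul (ψ 1 a) b - ψ 1 (S.mul a b)) ∧
    (∀ a b : A, D'.nu 1 a b - D.nu 1 a b = Dnn1 S (ψ 1) a b) ∧
    (∀ a : A, D'.al 1 a - D.al 1 a = S.alpha (ψ 1 a) - ψ 1 (S.alpha a)) ∧
    (∀ a : A, D'.al 1 a - D.al 1 a = Dna1 S (ψ 1) a) := by
  obtain ⟨h0, hν, hα⟩ := h
  have key_nu (a b : A) : D'.nu 1 a b - D.nu 1 a b
      = S.mul a (ψ 1 b) + S.mul (ψ 1 a) b - ψ 1 (S.mul a b) := by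
    have e := hν 1 a b
    simp [Finset.sum_range_succ, h0, D.nu_zero, D'.nu_zero] at e
    rw [sub_eq_sub_iff_add_eq_add, e]
  have key_al (a : A) : D'.al 1 a - D.al 1 a = S.alpha (ψ 1 a) - ψ 1 (S.alpha a) := by
    have e := hα 1 a
    simp [Finset.sum_range_succ, h0, D.al_zero, D'.al_zero] at e
    rw [sub_eq_sub_iff_add_eq_add, e]
  exact ⟨key_nu, key_nu, key_al, key_al⟩
end

section
/- Let (A, ·, α) be a Hom-pre-Lie algebra over a field K of characteristic zero, and let (ν_i, α_i)_{i≥0} be a formal deformation of A such that ν_i = 0 and α_i = 0 for 1 ≤ i < n, and whose n-th infinitesimal is a 2-coboundary: ν_n = −∂̃_{νν}φ_n and α_n = −∂̃_{να}φ_n for some K-linear map φ_n : A → A. Then (ν_i, α_i) is equivalent, via the formal isomorphism Ψ_t with ψ₀ = id, ψ_n = φ_n, and ψ_i = 0 for i ∉ {0, n}, to a formal deformation (ν̄_i, ᾱ_i) with ν̄_i = 0 and ᾱ_i = 0 for all 1 ≤ i ≤ n. -/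
open Finset

namespace FormalSeries

variable {K A : Type} [Field K] [AddCommGroup A] [Module K A]

/-- Multiplication by the formal parameter on `A⟦t⟧`, viewed as sequences in `A`. -/
def shift : (ℕ → A) →ₗ[K] (ℕ → A) where
  toFun x n := Nat.casesOn n 0 x
  map_add' x y := by ext n; cases n <;> simp
  map_smul' r x := by ext n; cases n <;> simp

@[simp] lemma shift_zero (x : ℕ → A) : shift (K := K) x 0 = 0 := rfl

@[simp] lemma shift_succ (x : ℕ → A) (n : ℕ) : shift (K := K) x (n + 1) = x n := rfl

/-- The inclusion of `A` into `A⟦t⟧` as constant series. -/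
def const : A →ₗ[K] (ℕ → A) := LinearMap.single K (fun _ => A) 0

@[simp] lemma const_zero (a : A) : const (K := K) a 0 = a := by simp [const]

@[simp] lemma const_succ (a : A) (n : ℕ) : const (K := K) a (n + 1) = 0 := by simp [const]

lemma eq_const_add_shift (x : ℕ → A) :
    x = const (K := K) (x 0) + shift (K := K) (fun n => x (n + 1)) := by
  ext n; cases n <;> simp

/-- An additive `t`-equivariant map on `A⟦t⟧` vanishing on constants is zero. -/
lemma eq_zero_of_const {F : (ℕ → A) → (ℕ → A)} (hadd : ∀ x y, F (x + y) = F x + F y)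
    (hshift : ∀ x, F (shift (K := K) x) = shift (K := K) (F x))
    (hconst : ∀ a, F (const (K := K) a) = 0) (x : ℕ → A) : F x = 0 := by
  ext n
  induction n generalizing x with
  | zero =>
    rw [eq_const_add_shift (K := K) x, hadd, hshift, hconst]; simp
  | succ n ih =>
    rw [eq_const_add_shift (K := K) x, hadd, hshift, hconst]; simpa using ih _

/-- The `t`-linear endomorphism `Σ fᵢ tⁱ` of `A⟦t⟧`. -/
def conv₁ (f : ℕ → (A →ₗ[K] A)) : (ℕ → A) →ₗ[K] (ℕ → A) where
  toFun x n := ∑ i ∈ range (n + 1), f i (x (n - i))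
  map_add' x y := by ext n; simp [sum_add_distrib]
  map_smul' r x := by ext n; simp [smul_sum]

lemma conv₁_apply (f : ℕ → (A →ₗ[K] A)) (x : ℕ → A) (n : ℕ) :
    conv₁ f x n = ∑ i ∈ range (n + 1), f i (x (n - i)) := rfl

lemma conv₁_shift (f : ℕ → (A →ₗ[K] A)) (x : ℕ → A) :
    conv₁ f (shift (K := K) x) = shift (K := K) (conv₁ f x) := by
  ext n
  cases n with
  | zero => simp [conv₁_apply]
  | succ n =>
    rw [conv₁_apply, sum_range_succ, shift_succ, conv₁_apply]
    simp only [Nat.sub_self, shift_zero, map_zero, add_zero]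
    refine sum_congr rfl fun i hi => ?_
    rw [Nat.succ_sub (by simpa [Nat.lt_succ_iff] using hi), shift_succ]

lemma conv₁_const (f : ℕ → (A →ₗ[K] A)) (a : A) :
    conv₁ f (const (K := K) a) = fun n => f n a := by
  ext n
  rw [conv₁_apply, sum_range_succ, sum_eq_zero]
  · simp
  · intro i hi
    obtain ⟨k, hk⟩ := Nat.exists_eq_add_of_lt (mem_range.mp hi)
    rw [show n - i = k + 1 by omega]; simp

/-- The `t`-bilinear product `Σ fᵢ tⁱ` on `A⟦t⟧`. -/
def conv₂ (f : ℕ → (A →ₗ[K] A →ₗ[K] A)) : (ℕ → A) →ₗ[K] (ℕ → A) →ₗ[K] (ℕ → A) :=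
  LinearMap.mk₂ K
    (fun x y n => ∑ i ∈ range (n + 1), ∑ j ∈ range (n + 1 - i), f i (x j) (y (n - i - j)))
    (fun x y z => by ext n; simp [sum_add_distrib])
    (fun r x y => by ext n; simp [smul_sum])
    (fun x y z => by ext n; simp [sum_add_distrib])
    (fun r x y => by ext n; simp [smul_sum])

lemma conv₂_apply (f : ℕ → (A →ₗ[K] A →ₗ[K] A)) (x y : ℕ → A) (n : ℕ) :
    conv₂ f x y n =
      ∑ i ∈ range (n + 1), ∑ j ∈ range (n + 1 - i), f i (x j) (y (n - i - j)) := rfl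

lemma conv₂_shift_left (f : ℕ → (A →ₗ[K] A →ₗ[K] A)) (x y : ℕ → A) :
    conv₂ f (shift (K := K) x) y = shift (K := K) (conv₂ f x y) := by
  ext n
  cases n with
  | zero => simp [conv₂_apply]
  | succ n =>
    rw [conv₂_apply, sum_range_succ, shift_succ, conv₂_apply]
    simp only [Nat.add_sub_cancel_left, sum_range_one, shift_zero, map_zero,
      LinearMap.zero_apply, add_zero]
    refine sum_congr rfl fun i hi => ?_
    have hi : i ≤ n := by simpa [Nat.lt_succ_iff] using hi
    rw [show n + 1 + 1 - i = n + 1 - i + 1 by omega, sum_range_succ']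
    simp only [shift_zero, map_zero, LinearMap.zero_apply, add_zero, shift_succ]
    exact sum_congr rfl fun j _ => by rw [show n + 1 - i - (j + 1) = n - i - j by omega]

lemma conv₂_shift_right (f : ℕ → (A →ₗ[K] A →ₗ[K] A)) (x y : ℕ → A) :
    conv₂ f x (shift (K := K) y) = shift (K := K) (conv₂ f x y) := by
  ext n
  cases n with
  | zero => simp [conv₂_apply]
  | succ n =>
    rw [conv₂_apply, sum_range_succ, shift_succ, conv₂_apply]
    simp only [Nat.add_sub_cancel_left, sum_range_one, Nat.sub_self, shift_zero, map_zero,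
      add_zero]
    refine sum_congr rfl fun i hi => ?_
    have hi : i ≤ n := by simpa [Nat.lt_succ_iff] using hi
    rw [show n + 1 + 1 - i = n + 1 - i + 1 by omega, sum_range_succ]
    simp only [Nat.sub_self, shift_zero, map_zero, add_zero]
    refine sum_congr rfl fun j hj => ?_
    have hj := mem_range.mp hj
    rw [show n + 1 - i - j = n - i - j + 1 by omega, shift_succ]

lemma conv₂_const (f : ℕ → (A →ₗ[K] A →ₗ[K] A)) (a b : A) :
    conv₂ f (const (K := K) a) (const (K := K) b) = fun n => f n a b := by
  ext n
  rw [conv₂_apply, sum_range_succ, sum_eq_zero]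
  · simp
  · intro i hi
    obtain ⟨k, hk⟩ := Nat.exists_eq_add_of_lt (mem_range.mp hi)
    refine sum_eq_zero fun j _ => ?_
    cases j with
    | zero => rw [show n - i - 0 = k + 1 by omega]; simp
    | succ j => simp

/-- The coefficients of an endomorphism of `A⟦t⟧`, restricted to constants. -/
def coeff₁ (F : (ℕ → A) →ₗ[K] (ℕ → A)) (n : ℕ) : A →ₗ[K] A :=
  LinearMap.proj n ∘ₗ F ∘ₗ const

/-- The coefficients of a product on `A⟦t⟧`, restricted to constants. -/
def coeff₂ (B : (ℕ → A) →ₗ[K] (ℕ → A) →ₗ[K] (ℕ → A)) (n : ℕ) : A →ₗ[K] A →ₗ[K] A :=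
  (B.compl₁₂ const const).compr₂ (LinearMap.proj n)

lemma conv₁_coeff₁ {F : (ℕ → A) →ₗ[K] (ℕ → A)}
    (hF : ∀ x, F (shift (K := K) x) = shift (K := K) (F x)) : conv₁ (coeff₁ F) = F := by
  refine LinearMap.ext fun x => sub_eq_zero.mp ?_
  refine eq_zero_of_const (K := K) (F := fun x => conv₁ (coeff₁ F) x - F x) ?_ ?_ ?_ x
  · intro x y; simp only [map_add]; abel
  · intro x; simp only [conv₁_shift, hF, map_sub]
  · intro a; simp only [conv₁_const]; exact sub_self _

lemma conv₂_coeff₂ {B : (ℕ → A) →ₗ[K] (ℕ → A) →ₗ[K] (ℕ → A)}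
    (hl : ∀ x y, B (shift (K := K) x) y = shift (K := K) (B x y))
    (hr : ∀ x y, B x (shift (K := K) y) = shift (K := K) (B x y)) :
    conv₂ (coeff₂ B) = B := by
  refine LinearMap.ext₂ fun x y => sub_eq_zero.mp ?_
  refine eq_zero_of_const (K := K) (F := fun x => conv₂ (coeff₂ B) x y - B x y) ?_ ?_ ?_ x
  · intro x y; simp only [map_add, LinearMap.add_apply]; abel
  · intro x; simp only [conv₂_shift_left, hl, map_sub]
  intro a
  refine eq_zero_of_const (K := K)
    (F := fun y => conv₂ (coeff₂ B) (const (K := K) a) y - B (const (K := K) a) y) ?_ ?_ ?_ y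
  · intro x y; simp only [map_add]; abel
  · intro x; simp only [conv₂_shift_right, hr, map_sub]
  · intro a; simp only [conv₂_const]; exact sub_self _

lemma conv₁_injective {ψ : ℕ → (A →ₗ[K] A)} (h0 : ∀ a, ψ 0 a = a) :
    Function.Injective (conv₁ ψ) := by
  rw [injective_iff_map_eq_zero]
  intro x hx
  ext n
  induction n using Nat.strong_induction_on with
  | _ n ih =>
    have h := congrFun hx n
    rw [conv₁_apply, sum_range_succ', sum_eq_zero] at h
    · simpa [h0] using h
    · intro i hi
      have hi := mem_range.mp hi
      rw [ih _ (by omega)]; simp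

/-- The series `x` solving `(Σ ψᵢ tⁱ) x = y` when `ψ₀ = id`. -/
def solve (ψ : ℕ → (A →ₗ[K] A)) (y : ℕ → A) (n : ℕ) : A :=
  y n - ∑ i : Fin n, ψ (i + 1) (solve ψ y (n - (i + 1)))
termination_by n
decreasing_by have := i.isLt; omega

lemma conv₁_surjective {ψ : ℕ → (A →ₗ[K] A)} (h0 : ∀ a, ψ 0 a = a) :
    Function.Surjective (conv₁ ψ) := by
  refine fun y => ⟨solve ψ y, ?_⟩
  ext n
  rw [conv₁_apply, sum_range_succ', h0, Nat.sub_zero, solve,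
    ← Fin.sum_univ_eq_sum_range (fun i => ψ (i + 1) (solve ψ y (n - (i + 1))))]
  abel

end FormalSeries

open FormalSeries

section Deformation

variable {K A : Type} [Field K] [AddCommGroup A] [Module K A] {S : HomPreLieStr K A}

/-- The deformed Hom-pre-Lie identity holds for all formal series. -/
lemma FormalDef.conv_homPreLie (D : FormalDef S) (x y z : ℕ → A) :
    conv₂ D.nu (conv₂ D.nu x y) (conv₁ D.al z) - conv₂ D.nu (conv₁ D.al x) (conv₂ D.nu y z)
      - conv₂ D.nu (conv₂ D.nu y x) (conv₁ D.al z)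
      + conv₂ D.nu (conv₁ D.al y) (conv₂ D.nu x z) = 0 := by
  refine eq_zero_of_const (K := K) (F := fun x =>
    conv₂ D.nu (conv₂ D.nu x y) (conv₁ D.al z) - conv₂ D.nu (conv₁ D.al x) (conv₂ D.nu y z)
      - conv₂ D.nu (conv₂ D.nu y x) (conv₁ D.al z)
      + conv₂ D.nu (conv₁ D.al y) (conv₂ D.nu x z)) ?_ ?_ (fun a => ?_) x
  · intro x y; simp only [map_add, LinearMap.add_apply]; abel
  · intro x
    simp only [conv₂_shift_left, conv₂_shift_right, conv₁_shift, map_sub, map_add]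
  refine eq_zero_of_const (K := K) (F := fun y =>
    conv₂ D.nu (conv₂ D.nu (const (K := K) a) y) (conv₁ D.al z)
      - conv₂ D.nu (conv₁ D.al (const (K := K) a)) (conv₂ D.nu y z)
      - conv₂ D.nu (conv₂ D.nu y (const (K := K) a)) (conv₁ D.al z)
      + conv₂ D.nu (conv₁ D.al y) (conv₂ D.nu (const (K := K) a) z)) ?_ ?_ (fun b => ?_) y
  · intro x y; simp only [map_add, LinearMap.add_apply]; abel
  · intro x
    simp only [conv₂_shift_left, conv₂_shift_right, conv₁_shift, map_sub, map_add]
  refine eq_zero_of_const (K := K) (F := fun z =>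
    conv₂ D.nu (conv₂ D.nu (const (K := K) a) (const (K := K) b)) (conv₁ D.al z)
      - conv₂ D.nu (conv₁ D.al (const (K := K) a)) (conv₂ D.nu (const (K := K) b) z)
      - conv₂ D.nu (conv₂ D.nu (const (K := K) b) (const (K := K) a)) (conv₁ D.al z)
      + conv₂ D.nu (conv₁ D.al (const (K := K) b)) (conv₂ D.nu (const (K := K) a) z))
    ?_ ?_ (fun c => ?_) z
  · intro x y; simp only [map_add]; abel
  · intro x
    simp only [conv₂_shift_right, conv₁_shift, map_sub, map_add]
  · ext n
    have h := D.deform n a b c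
    simp only [sum_add_distrib, sum_sub_distrib] at h
    simp only [conv₂_const, conv₁_const]
    exact h

/-- The deformed structure map is multiplicative on all formal series. -/
lemma FormalDef.conv_alpha_mult (D : FormalDef S) (x y : ℕ → A) :
    conv₂ D.nu (conv₁ D.al x) (conv₁ D.al y) = conv₁ D.al (conv₂ D.nu x y) := by
  refine sub_eq_zero.mp ?_
  refine eq_zero_of_const (K := K) (F := fun x =>
    conv₂ D.nu (conv₁ D.al x) (conv₁ D.al y) - conv₁ D.al (conv₂ D.nu x y))
    ?_ ?_ (fun a => ?_) x
  · intro x y; simp only [map_add, LinearMap.add_apply]; abel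
  · intro x; simp only [conv₂_shift_left, conv₁_shift, map_sub]
  refine eq_zero_of_const (K := K) (F := fun y =>
    conv₂ D.nu (conv₁ D.al (const (K := K) a)) (conv₁ D.al y)
      - conv₁ D.al (conv₂ D.nu (const (K := K) a) y)) ?_ ?_ (fun b => ?_) y
  · intro x y; simp only [map_add]; abel
  · intro x; simp only [conv₂_shift_right, conv₁_shift, map_sub]
  · simp only [conv₂_const, conv₁_const]
    exact sub_eq_zero.mpr (funext fun n => D.deform_alpha n a b)

/-- Every formal isomorphism transports a formal deformation to an equivalent one. -/
lemma FormalDef.exists_areEquiv (D : FormalDef S) (ψ : ℕ → (A →ₗ[K] A))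
    (h0 : ∀ a, ψ 0 a = a) : ∃ D' : FormalDef S, AreEquiv D D' ψ := by
  let Ψ := LinearEquiv.ofBijective (conv₁ ψ) ⟨conv₁_injective h0, conv₁_surjective h0⟩
  have hΨ : ∀ x, Ψ (shift (K := K) x) = shift (K := K) (Ψ x) := conv₁_shift ψ
  have hΨs : ∀ x, Ψ.symm (shift (K := K) x) = shift (K := K) (Ψ.symm x) := fun x => by
    rw [LinearEquiv.symm_apply_eq, hΨ, Ψ.apply_symm_apply]
  let N := ((conv₂ D.nu).compl₁₂ Ψ.toLinearMap Ψ.toLinearMap).compr₂ Ψ.symm.toLinearMap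
  let L := Ψ.symm.toLinearMap ∘ₗ conv₁ D.al ∘ₗ Ψ.toLinearMap
  have hN (x y) : N x y = Ψ.symm (conv₂ D.nu (Ψ x) (Ψ y)) := rfl
  have hL (x) : L x = Ψ.symm (conv₁ D.al (Ψ x)) := rfl
  have cN : conv₂ (coeff₂ N) = N := conv₂_coeff₂
    (fun x y => by rw [hN, hΨ, conv₂_shift_left, hΨs, hN])
    (fun x y => by rw [hN, hΨ, conv₂_shift_right, hΨs, hN])
  have cL : conv₁ (coeff₁ L) = L := conv₁_coeff₁
    (fun x => by rw [hL, hΨ, conv₁_shift, hΨs, hL])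
  have eN (a b : A) : (fun n => coeff₂ N n a b) = N (const (K := K) a) (const (K := K) b) := rfl
  have eL (a : A) : (fun n => coeff₁ L n a) = L (const (K := K) a) := rfl
  have eΨ (a : A) : Ψ (const (K := K) a) = fun n => ψ n a := conv₁_const ψ a
  have equivN (n : ℕ) (a b : A) : (∑ i ∈ range (n + 1), ψ i (coeff₂ N (n - i) a b))
      = ∑ i ∈ range (n + 1), ∑ j ∈ range (n + 1 - i), D.nu i (ψ j a) (ψ (n - i - j) b) := by
    change Ψ (fun n => coeff₂ N n a b) n = conv₂ D.nu (fun n => ψ n a) (fun n => ψ n b) n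
    rw [eN, hN, Ψ.apply_symm_apply, eΨ, eΨ]
  have equivL (n : ℕ) (a : A) : (∑ i ∈ range (n + 1), D.al i (ψ (n - i) a))
      = ∑ i ∈ range (n + 1), ψ i (coeff₁ L (n - i) a) := by
    change conv₁ D.al (fun n => ψ n a) n = Ψ (fun n => coeff₁ L n a) n
    rw [eL, hL, Ψ.apply_symm_apply, eΨ]
  refine ⟨⟨coeff₂ N, coeff₁ L, ?_, ?_, ?_, ?_⟩, h0, equivN, equivL⟩
  · intro a b; simpa [h0, D.nu_zero] using equivN 0 a b
  · intro a; simpa [h0, D.al_zero] using (equivL 0 a).symm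
  · intro n a b c
    simp only [sum_add_distrib, sum_sub_distrib]
    have homPreLie (x y z : ℕ → A) :
        N (N x y) (L z) - N (L x) (N y z) - N (N y x) (L z) + N (L y) (N x z) = 0 := by
      simp only [hN, hL, Ψ.apply_symm_apply, ← map_sub, ← map_add]
      rw [D.conv_homPreLie, map_zero]
    have h := homPreLie (const (K := K) a) (const (K := K) b) (const (K := K) c)
    rw [← cN] at h
    simp only [conv₂_const] at h
    rw [← cL] at h
    simp only [conv₁_const] at h
    exact congrFun h n
  · intro n a b
    have alpha_mult (x y : ℕ → A) : N (L x) (L y) = L (N x y) := by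
      simp only [hN, hL, Ψ.apply_symm_apply, D.conv_alpha_mult]
    have h := alpha_mult (const (K := K) a) (const (K := K) b)
    rw [← cN, ← cL] at h
    simp only [conv₂_const, conv₁_const] at h
    exact congrFun h n

end Deformation

/-- If the `n`-th infinitesimal `(ν_n, α_n)` of a formal deformation (whose terms
of orders `1 ≤ i < n` vanish) is a coboundary, `ν_n = −∂̃_{νν}φ_n` and
`α_n = −∂̃_{να}φ_n`, then the deformation is equivalent — via the formal
isomorphism with `ψ₀ = id`, `ψ_n = φ_n` and `ψ_i = 0` otherwise — to a formal
deformation all of whose terms of orders `1 ≤ i ≤ n` vanish. -/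
theorem kill_coboundary_infinitesimal (K A : Type) [Field K] [CharZero K]
    [AddCommGroup A] [Module K A] (S : HomPreLieStr K A)
    (D : FormalDef S) (n : ℕ) (hn : 1 ≤ n)
    (hvanish : ∀ i, 1 ≤ i → i < n →
      (∀ a b : A, D.nu i a b = 0) ∧ (∀ a : A, D.al i a = 0))
    (φ : A →ₗ[K] A)
    (hφν : ∀ a b : A, D.nu n a b = -(Dnn1 S φ a b))
    (hφα : ∀ a : A, D.al n a = -(Dna1 S φ a)) :
    ∃ D' : FormalDef S,
      AreEquiv D D'
        (fun i => if i = 0 then LinearMap.id else if i = n then φ else 0) ∧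
      (∀ i, 1 ≤ i → i ≤ n →
        (∀ a b : A, D'.nu i a b = 0) ∧ (∀ a : A, D'.al i a = 0)) := by
  obtain ⟨D', hD'⟩ := D.exists_areEquiv
    (fun i => if i = 0 then LinearMap.id else if i = n then φ else 0) (fun a => by simp)
  refine ⟨D', hD', fun i hi hin => ?_⟩
  obtain ⟨-, hν, hα⟩ := hD'
  obtain ⟨m, rfl⟩ : ∃ m, i = m + 1 := ⟨i - 1, by omega⟩
  have hne : ∀ k ∈ range m, k + 1 ≠ n := fun k hk => by
    have := mem_range.mp hk
    omega
  have hνmid : ∀ k ∈ range m, ∀ a b, D.nu (k + 1) a b = 0 := fun k hk =>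
    (hvanish (k + 1) (by omega) (by have := mem_range.mp hk; omega)).1
  have hαmid : ∀ k ∈ range m, ∀ a, D.al (k + 1) a = 0 := fun k hk =>
    (hvanish (k + 1) (by omega) (by have := mem_range.mp hk; omega)).2
  constructor
  · intro a b
    have h := hν (m + 1) a b
    rw [sum_range_succ', sum_range_succ, sum_eq_zero (fun k hk => by simp [hne k hk]),
      sum_range_succ', sum_range_succ,
      sum_eq_zero (fun k hk => sum_eq_zero fun j _ => hνmid k hk _ _),
      Nat.add_sub_cancel_left, sum_range_one, Nat.sub_zero (m + 1 + 1), sum_range_succ', sum_range_succ,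
      sum_eq_zero (fun k hk => by simp [hne k hk])] at h
    rcases hin.lt_or_eq with hlt | rfl
    · simpa [hlt.ne, (hvanish _ hi hlt).1] using h
    · simp [hφν, Dnn1, D.nu_zero, D'.nu_zero] at h
      rw [← sub_eq_zero] at h
      rw [← h]; abel
  · intro a
    have h := hα (m + 1) a
    rw [sum_range_succ', sum_range_succ, sum_eq_zero (fun k hk => hαmid k hk _),
      sum_range_succ', sum_range_succ, sum_eq_zero (fun k hk => by simp [hne k hk])] at h
    rcases hin.lt_or_eq with hlt | rfl
    · simpa [hlt.ne, (hvanish _ hi hlt).2] using h.symm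
    · simpa [hφα, Dna1, D.al_zero, D'.al_zero] using h
end

section
/- Let (A, ·, α) be a Hom-pre-Lie algebra over a field K of characteristic zero whose second α-type cohomology with coefficients in the regular representation vanishes, i.e., every 2-cocycle (ν', α') (a bilinear map ν' : A×A→A and a linear map α' : A→A with ∂̃_{νν}ν' − ∂̃_{αν}α' = 0 and ∂̃_{να}ν' − ∂̃_{αα}α' = 0) is a 2-coboundary (there exists a linear φ : A → A with ν' = ∂̃_{νν}φ and α' = ∂̃_{να}φ). Then A is rigid: every formal deformation of A is equivalent to the trivial deformation. -/
open Finset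

/-- A sequence all of whose finite initial segments satisfy a local condition exists as soon as
every admissible initial segment can be extended by one term. -/
theorem exists_seq_of_step {β : Type*} [Nonempty β] (P : ℕ → (ℕ → β) → Prop)
    (hloc : ∀ n f g, (∀ i ≤ n, f i = g i) → P n f → P n g)
    (hstep : ∀ n f, (∀ m < n, P m f) → ∃ b, P n (Function.update f n b)) :
    ∃ f, ∀ n, P n f := by
  have hext : ∀ n (f : {f : ℕ → β // ∀ m < n, P m f}),
      ∃ b, ∀ m < n + 1, P m (Function.update f.1 n b) := by
    rintro n ⟨f, hf⟩
    obtain ⟨b, hb⟩ := hstep n f hf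
    refine ⟨b, fun m hm => ?_⟩
    rcases Nat.lt_succ_iff_lt_or_eq.mp hm with h | rfl
    · refine hloc m f _ (fun i hi => ?_) (hf m h)
      rw [Function.update_of_ne (by omega)]
    · exact hb
  choose b hb using hext
  let G : ∀ n, {f : ℕ → β // ∀ m < n, P m f} := fun n =>
    Nat.rec ⟨fun _ => Classical.arbitrary β, fun m hm => absurd hm (Nat.not_lt_zero m)⟩
      (fun k f => ⟨Function.update f.1 k (b k f), hb k f⟩) n
  have hG : ∀ n, (G (n + 1)).1 = Function.update (G n).1 n (b n (G n)) := fun _ => rfl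
  have hstable : ∀ i k, (G (i + 1 + k)).1 i = (G (i + 1)).1 i := by
    intro i k
    induction k with
    | zero => rfl
    | succ k ih => rw [← add_assoc, hG, Function.update_of_ne (by omega), ih]
  refine ⟨fun n => (G (n + 1)).1 n, fun n => ?_⟩
  refine hloc n _ _ (fun i hi => ?_) ((G (n + 1)).2 n (Nat.lt_succ_self n))
  obtain ⟨k, rfl⟩ := Nat.exists_eq_add_of_le hi
  rw [← hstable i k, show i + 1 + k = i + k + 1 by omega]

section FormalSeries

variable {K A : Type} [Field K] [AddCommGroup A] [Module K A]

/-- The product of two formal series with coefficients in `A` under the formal bilinear map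
`∑ νᵢ tⁱ`. -/
def seriesMul (ν : ℕ → (A →ₗ[K] A →ₗ[K] A)) (x y : ℕ → A) (n : ℕ) : A :=
  ∑ p ∈ antidiagonal n, ∑ q ∈ antidiagonal p.2, ν p.1 (x q.1) (y q.2)

/-- The image of a formal series with coefficients in `A` under the formal linear map
`∑ αᵢ tⁱ`. -/
def seriesMap (α : ℕ → (A →ₗ[K] A)) (x : ℕ → A) (n : ℕ) : A :=
  ∑ p ∈ antidiagonal n, α p.1 (x p.2)

/-- Multiplication of a formal series by the variable. -/
def seriesShift (x : ℕ → A) : ℕ → A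
  | 0 => 0
  | n + 1 => x n

theorem eq_single_add_seriesShift (x : ℕ → A) :
    x = Pi.single 0 (x 0) + seriesShift (fun i => x (i + 1)) := by
  funext n
  cases n <;> simp [seriesShift]

variable (ν : ℕ → (A →ₗ[K] A →ₗ[K] A)) (α : ℕ → (A →ₗ[K] A))

theorem seriesMul_eq_range (x y : ℕ → A) (n : ℕ) :
    seriesMul ν x y n = ∑ i ∈ Finset.range (n + 1), ∑ j ∈ Finset.range (n + 1 - i),
      ν i (x j) (y (n - i - j)) := by
  rw [seriesMul, Finset.Nat.sum_antidiagonal_eq_sum_range_succ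
    (fun i m => ∑ q ∈ antidiagonal m, ν i (x q.1) (y q.2))]
  refine Finset.sum_congr rfl fun i hi => ?_
  rw [Finset.Nat.sum_antidiagonal_eq_sum_range_succ (fun j k => ν i (x j) (y k)),
    Nat.succ_eq_add_one, Nat.sub_add_comm (Finset.mem_range_succ_iff.mp hi)]

theorem seriesMap_eq_range (x : ℕ → A) (n : ℕ) :
    seriesMap α x n = ∑ i ∈ Finset.range (n + 1), α i (x (n - i)) :=
  Finset.Nat.sum_antidiagonal_eq_sum_range_succ (fun i j => α i (x j)) n

theorem seriesMul_add_left (x x' y : ℕ → A) :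
    seriesMul ν (x + x') y = seriesMul ν x y + seriesMul ν x' y := by
  funext n; simp [seriesMul, Finset.sum_add_distrib]

theorem seriesMul_add_right (x y y' : ℕ → A) :
    seriesMul ν x (y + y') = seriesMul ν x y + seriesMul ν x y' := by
  funext n; simp [seriesMul, Finset.sum_add_distrib]

theorem seriesMul_sub_left (x x' y : ℕ → A) :
    seriesMul ν (x - x') y = seriesMul ν x y - seriesMul ν x' y := by
  funext n; simp [seriesMul, Finset.sum_sub_distrib]

theorem seriesMul_sub_right (x y y' : ℕ → A) :
    seriesMul ν x (y - y') = seriesMul ν x y - seriesMul ν x y' := by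
  funext n; simp [seriesMul, Finset.sum_sub_distrib]

theorem seriesMul_smul_left (c : K) (x y : ℕ → A) :
    seriesMul ν (c • x) y = c • seriesMul ν x y := by
  funext n; simp [seriesMul, Finset.smul_sum]

theorem seriesMul_smul_right (c : K) (x y : ℕ → A) :
    seriesMul ν x (c • y) = c • seriesMul ν x y := by
  funext n; simp [seriesMul, Finset.smul_sum]

theorem seriesMap_add (x y : ℕ → A) :
    seriesMap α (x + y) = seriesMap α x + seriesMap α y := by
  funext n; simp [seriesMap, Finset.sum_add_distrib]

theorem seriesMap_sub (x y : ℕ → A) :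
    seriesMap α (x - y) = seriesMap α x - seriesMap α y := by
  funext n; simp [seriesMap, Finset.sum_sub_distrib]

theorem seriesMap_smul (c : K) (x : ℕ → A) :
    seriesMap α (c • x) = c • seriesMap α x := by
  funext n; simp [seriesMap, Finset.smul_sum]

theorem seriesMul_shift_left (x y : ℕ → A) :
    seriesMul ν (seriesShift x) y = seriesShift (seriesMul ν x y) := by
  funext n
  cases n with
  | zero => simp [seriesMul, seriesShift]
  | succ n =>
    simp [seriesMul, seriesShift, Finset.Nat.sum_antidiagonal_succ' (n := n),
      Finset.Nat.sum_antidiagonal_succ]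

theorem seriesMul_shift_right (x y : ℕ → A) :
    seriesMul ν x (seriesShift y) = seriesShift (seriesMul ν x y) := by
  funext n
  cases n with
  | zero => simp [seriesMul, seriesShift]
  | succ n => simp [seriesMul, seriesShift, Finset.Nat.sum_antidiagonal_succ']

theorem seriesMap_shift (x : ℕ → A) :
    seriesMap α (seriesShift x) = seriesShift (seriesMap α x) := by
  funext n
  cases n with
  | zero => simp [seriesMap, seriesShift]
  | succ n => simp [seriesMap, seriesShift, Finset.Nat.sum_antidiagonal_succ']

theorem seriesMul_single_single (a b : A) :
    seriesMul ν (Pi.single 0 a) (Pi.single 0 b) = fun n => ν n a b := by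
  funext n
  rw [seriesMul, Finset.sum_eq_single (n, 0)]
  · simp
  · rintro ⟨i, j⟩ h hne
    refine Finset.sum_eq_zero ?_
    rintro ⟨k, l⟩ h'
    simp only [HasAntidiagonal.mem_antidiagonal, ne_eq, Prod.mk.injEq] at h h' hne
    rcases Nat.eq_zero_or_pos k with rfl | hk
    · have : l ≠ 0 := by omega
      simp [Pi.single_eq_of_ne this]
    · simp [Pi.single_eq_of_ne hk.ne']
  · simp

theorem seriesMap_single (a : A) : seriesMap α (Pi.single 0 a) = fun n => α n a := by
  funext n
  rw [seriesMap, Finset.sum_eq_single (n, 0)]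
  · simp
  · rintro ⟨i, j⟩ h hne
    simp only [HasAntidiagonal.mem_antidiagonal, ne_eq, Prod.mk.injEq] at h hne
    have : j ≠ 0 := by omega
    simp [Pi.single_eq_of_ne this]
  · simp

theorem seriesMul_of_vanish_left {n : ℕ} {x : ℕ → A} (hx : ∀ i < n, x i = 0) (y : ℕ → A) :
    seriesMul ν x y n = ν 0 (x n) (y 0) := by
  rw [seriesMul, Finset.sum_eq_single (0, n), Finset.sum_eq_single (n, 0)]
  · rintro ⟨k, l⟩ h hne
    simp only [HasAntidiagonal.mem_antidiagonal, ne_eq, Prod.mk.injEq] at h hne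
    simp [hx k (by omega)]
  · simp
  · rintro ⟨i, j⟩ h hne
    refine Finset.sum_eq_zero ?_
    rintro ⟨k, l⟩ h'
    simp only [HasAntidiagonal.mem_antidiagonal, ne_eq, Prod.mk.injEq] at h h' hne
    simp [hx k (by omega)]
  · simp

theorem seriesMul_of_vanish_right {n : ℕ} (x : ℕ → A) {y : ℕ → A} (hy : ∀ i < n, y i = 0) :
    seriesMul ν x y n = ν 0 (x 0) (y n) := by
  rw [seriesMul, Finset.sum_eq_single (0, n), Finset.sum_eq_single (0, n)]
  · rintro ⟨k, l⟩ h hne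
    simp only [HasAntidiagonal.mem_antidiagonal, ne_eq, Prod.mk.injEq] at h hne
    simp [hy l (by omega)]
  · simp
  · rintro ⟨i, j⟩ h hne
    refine Finset.sum_eq_zero ?_
    rintro ⟨k, l⟩ h'
    simp only [HasAntidiagonal.mem_antidiagonal, ne_eq, Prod.mk.injEq] at h h' hne
    simp [hy l (by omega)]
  · simp

theorem seriesMap_of_vanish {n : ℕ} {x : ℕ → A} (hx : ∀ i < n, x i = 0) :
    seriesMap α x n = α 0 (x n) := by
  rw [seriesMap, Finset.sum_eq_single (0, n)]
  · rintro ⟨i, j⟩ h hne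
    simp only [HasAntidiagonal.mem_antidiagonal, ne_eq, Prod.mk.injEq] at h hne
    simp [hx j (by omega)]
  · simp

theorem seriesMul_congr {n : ℕ} {x x' y y' : ℕ → A} (hx : ∀ i ≤ n, x i = x' i)
    (hy : ∀ i ≤ n, y i = y' i) : seriesMul ν x y n = seriesMul ν x' y' n := by
  refine Finset.sum_congr rfl fun p hp => Finset.sum_congr rfl fun q hq => ?_
  rw [HasAntidiagonal.mem_antidiagonal] at hp hq
  rw [hx _ (by omega), hy _ (by omega)]

theorem seriesMap_congr {n : ℕ} {x x' : ℕ → A} (hx : ∀ i ≤ n, x i = x' i) :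
    seriesMap α x n = seriesMap α x' n := by
  refine Finset.sum_congr rfl fun p hp => ?_
  rw [HasAntidiagonal.mem_antidiagonal] at hp
  rw [hx _ (by omega)]

/-- The left-symmetry defect of the Hom-associator of a formal product, on formal series. -/
def seriesDefect (x y z : ℕ → A) : ℕ → A :=
  seriesMul ν (seriesMul ν x y) (seriesMap α z) - seriesMul ν (seriesMap α x) (seriesMul ν y z)
    - seriesMul ν (seriesMul ν y x) (seriesMap α z)
    + seriesMul ν (seriesMap α y) (seriesMul ν x z)

theorem seriesShift_sub_sub_add (x y z w : ℕ → A) :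
    seriesShift x - seriesShift y - seriesShift z + seriesShift w
      = seriesShift (x - y - z + w) := by
  funext n
  cases n <;> simp [seriesShift]

theorem seriesDefect_shift₁ (x y z : ℕ → A) :
    seriesDefect ν α (seriesShift x) y z = seriesShift (seriesDefect ν α x y z) := by
  simp only [seriesDefect, seriesMul_shift_left, seriesMul_shift_right, seriesMap_shift,
    seriesShift_sub_sub_add]

theorem seriesDefect_shift₂ (x y z : ℕ → A) :
    seriesDefect ν α x (seriesShift y) z = seriesShift (seriesDefect ν α x y z) := by
  simp only [seriesDefect, seriesMul_shift_left, seriesMul_shift_right, seriesMap_shift,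
    seriesShift_sub_sub_add]

theorem seriesDefect_shift₃ (x y z : ℕ → A) :
    seriesDefect ν α x y (seriesShift z) = seriesShift (seriesDefect ν α x y z) := by
  simp only [seriesDefect, seriesMul_shift_right, seriesMap_shift, seriesShift_sub_sub_add]

theorem seriesDefect_add₁ (x x' y z : ℕ → A) :
    seriesDefect ν α (x + x') y z = seriesDefect ν α x y z + seriesDefect ν α x' y z := by
  simp only [seriesDefect, seriesMul_add_left, seriesMul_add_right, seriesMap_add]
  abel

theorem seriesDefect_add₂ (x y y' z : ℕ → A) :
    seriesDefect ν α x (y + y') z = seriesDefect ν α x y z + seriesDefect ν α x y' z := by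
  simp only [seriesDefect, seriesMul_add_left, seriesMul_add_right, seriesMap_add]
  abel

theorem seriesDefect_add₃ (x y z z' : ℕ → A) :
    seriesDefect ν α x y (z + z') = seriesDefect ν α x y z + seriesDefect ν α x y z' := by
  simp only [seriesDefect, seriesMul_add_right, seriesMap_add]
  abel

theorem seriesShift_eq_zero_of_lt {x : ℕ → A} {n : ℕ} (hx : ∀ m < n, x m = 0) :
    seriesShift x n = 0 := by
  cases n with
  | zero => rfl
  | succ n => exact hx n (Nat.lt_succ_self n)

/-- The formal product of a deformation satisfies the Hom-pre-Lie identity on all formal series. -/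
theorem FormalDef.seriesDefect_eq_zero {S : HomPreLieStr K A} (D : FormalDef S) (n : ℕ)
    (x y z : ℕ → A) : seriesDefect D.nu D.al x y z n = 0 := by
  induction n using Nat.strong_induction_on generalizing x y z with
  | _ n ih =>
    rw [eq_single_add_seriesShift x, seriesDefect_add₁, seriesDefect_shift₁, Pi.add_apply,
      seriesShift_eq_zero_of_lt (fun m hm => ih m hm _ _ _), add_zero,
      eq_single_add_seriesShift y, seriesDefect_add₂, seriesDefect_shift₂, Pi.add_apply,
      seriesShift_eq_zero_of_lt (fun m hm => ih m hm _ _ _), add_zero,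
      eq_single_add_seriesShift z, seriesDefect_add₃, seriesDefect_shift₃, Pi.add_apply,
      seriesShift_eq_zero_of_lt (fun m hm => ih m hm _ _ _), add_zero]
    rw [← D.deform n (x 0) (y 0) (z 0)]
    simp only [seriesDefect, seriesMul_single_single, seriesMap_single, Pi.add_apply,
      Pi.sub_apply, seriesMul_eq_range, Finset.sum_add_distrib, Finset.sum_sub_distrib]

/-- The formal structure map of a deformation is multiplicative on all formal series. -/
theorem FormalDef.seriesMap_seriesMul {S : HomPreLieStr K A} (D : FormalDef S) (n : ℕ)
    (x y : ℕ → A) :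
    seriesMap D.al (seriesMul D.nu x y) n
      = seriesMul D.nu (seriesMap D.al x) (seriesMap D.al y) n := by
  induction n using Nat.strong_induction_on generalizing x y with
  | _ n ih =>
    have hshift : ∀ u v : ℕ → A, seriesShift (seriesMap D.al (seriesMul D.nu u v)) n
        = seriesShift (seriesMul D.nu (seriesMap D.al u) (seriesMap D.al v)) n := by
      intro u v
      cases n with
      | zero => rfl
      | succ n => exact ih n (Nat.lt_succ_self n) u v
    rw [eq_single_add_seriesShift x]
    simp only [seriesMul_add_left, seriesMap_add, seriesMul_shift_left, seriesMap_shift,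
      Pi.add_apply, hshift]
    congr 1
    rw [eq_single_add_seriesShift y]
    simp only [seriesMul_add_right, seriesMap_add, seriesMul_shift_right, seriesMap_shift,
      Pi.add_apply, hshift]
    congr 1
    simp only [seriesMul_single_single, seriesMap_single]
    rw [seriesMap_eq_range, seriesMul_eq_range, D.deform_alpha n (x 0) (y 0)]

end FormalSeries

section Rigidity

variable {K A : Type} [Field K] [AddCommGroup A] [Module K A] {S : HomPreLieStr K A}

/-- The orbit series `∑ ψᵢ(a) tⁱ` of an element under a formal linear map. -/
def orbitSeries (ψ : ℕ → (A →ₗ[K] A)) (a : A) : ℕ → A := fun i => ψ i a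

theorem orbitSeries_add (ψ : ℕ → (A →ₗ[K] A)) (a b : A) :
    orbitSeries ψ (a + b) = orbitSeries ψ a + orbitSeries ψ b := by
  funext i; simp [orbitSeries]

theorem orbitSeries_smul (ψ : ℕ → (A →ₗ[K] A)) (c : K) (a : A) :
    orbitSeries ψ (c • a) = c • orbitSeries ψ a := by
  funext i; simp [orbitSeries]

theorem orbitSeries_update (ψ : ℕ → (A →ₗ[K] A)) (n : ℕ) (φ : A →ₗ[K] A) (a : A) :
    orbitSeries (Function.update ψ n φ) a
      = orbitSeries (Function.update ψ n 0) a + Pi.single n (φ a) := by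
  funext i
  rcases eq_or_ne i n with rfl | h
  · simp [orbitSeries]
  · simp [orbitSeries, h]

/-- The failure of `∑ ψᵢ tⁱ` to be multiplicative from the undeformed to the deformed product. -/
def mulDefect (D : FormalDef S) (ψ : ℕ → (A →ₗ[K] A)) (a b : A) : ℕ → A :=
  orbitSeries ψ (S.mul a b) - seriesMul D.nu (orbitSeries ψ a) (orbitSeries ψ b)

/-- The failure of `∑ ψᵢ tⁱ` to intertwine the undeformed and the deformed structure maps. -/
def mapDefect (D : FormalDef S) (ψ : ℕ → (A →ₗ[K] A)) (a : A) : ℕ → A :=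
  orbitSeries ψ (S.alpha a) - seriesMap D.al (orbitSeries ψ a)

/-- The coefficient of order `n` of `mulDefect`, as a bilinear map. -/
def mulDefectCoeff (D : FormalDef S) (ψ : ℕ → (A →ₗ[K] A)) (n : ℕ) : A →ₗ[K] A →ₗ[K] A :=
  LinearMap.mk₂ K (fun a b => mulDefect D ψ a b n)
    (fun a a' b => by
      simp only [mulDefect, map_add, LinearMap.add_apply, orbitSeries_add, seriesMul_add_left,
        Pi.add_apply, Pi.sub_apply]
      abel)
    (fun c a b => by
      simp only [mulDefect, map_smul, LinearMap.smul_apply, orbitSeries_smul,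
        seriesMul_smul_left, Pi.smul_apply, Pi.sub_apply, smul_sub])
    (fun a b b' => by
      simp only [mulDefect, map_add, orbitSeries_add, seriesMul_add_right,
        Pi.add_apply, Pi.sub_apply]
      abel)
    (fun c a b => by
      simp only [mulDefect, map_smul, orbitSeries_smul,
        seriesMul_smul_right, Pi.smul_apply, Pi.sub_apply, smul_sub])

/-- The coefficient of order `n` of `mapDefect`, as a linear map. -/
def mapDefectCoeff (D : FormalDef S) (ψ : ℕ → (A →ₗ[K] A)) (n : ℕ) : A →ₗ[K] A where
  toFun a := mapDefect D ψ a n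
  map_add' a b := by
    simp only [mapDefect, map_add, orbitSeries_add, seriesMap_add, Pi.add_apply, Pi.sub_apply]
    abel
  map_smul' c a := by
    simp only [mapDefect, map_smul, orbitSeries_smul, seriesMap_smul, Pi.smul_apply,
      Pi.sub_apply, smul_sub, RingHom.id_apply]

theorem mulDefectCoeff_apply (D : FormalDef S) (ψ : ℕ → (A →ₗ[K] A)) (n : ℕ) (a b : A) :
    mulDefectCoeff D ψ n a b = mulDefect D ψ a b n := rfl

theorem mapDefectCoeff_apply (D : FormalDef S) (ψ : ℕ → (A →ₗ[K] A)) (n : ℕ) (a : A) :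
    mapDefectCoeff D ψ n a = mapDefect D ψ a n := rfl

theorem seriesMul_orbit_eq (D : FormalDef S) (ψ : ℕ → (A →ₗ[K] A)) (a b : A) :
    seriesMul D.nu (orbitSeries ψ a) (orbitSeries ψ b)
      = orbitSeries ψ (S.mul a b) - mulDefect D ψ a b := by
  rw [mulDefect, sub_sub_cancel]

theorem seriesMap_orbit_eq (D : FormalDef S) (ψ : ℕ → (A →ₗ[K] A)) (a : A) :
    seriesMap D.al (orbitSeries ψ a) = orbitSeries ψ (S.alpha a) - mapDefect D ψ a := by
  rw [mapDefect, sub_sub_cancel]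

/-- Leading coefficient of the product of perturbed orbit series. -/
theorem seriesMul_orbit_sub_orbit_sub (D : FormalDef S) {ψ : ℕ → (A →ₗ[K] A)}
    (h0 : ∀ a, ψ 0 a = a) {n : ℕ} (hn : 0 < n) (u v : A) {s r : ℕ → A}
    (hs : ∀ i < n, s i = 0) (hr : ∀ i < n, r i = 0) :
    seriesMul D.nu (orbitSeries ψ u - s) (orbitSeries ψ v - r) n
      = ψ n (S.mul u v) - mulDefectCoeff D ψ n u v - S.mul (s n) v - S.mul u (r n) := by
  rw [seriesMul_sub_left, Pi.sub_apply, seriesMul_of_vanish_left _ hs, seriesMul_sub_right,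
    Pi.sub_apply, seriesMul_of_vanish_right _ _ hr, seriesMul_orbit_eq, D.nu_zero, D.nu_zero,
    Pi.sub_apply, Pi.sub_apply, hr 0 hn, mulDefectCoeff_apply]
  simp only [orbitSeries, h0, sub_zero]
  abel

/-- Leading defects of a formal map into a deformation form a 2-cocycle. -/
theorem defectCoeff_cocycle (D : FormalDef S) {ψ : ℕ → (A →ₗ[K] A)} (h0 : ∀ a, ψ 0 a = a)
    {n : ℕ} (hn : 0 < n) (hmul : ∀ m < n, ∀ a b, mulDefect D ψ a b m = 0)
    (hmap : ∀ m < n, ∀ a, mapDefect D ψ a m = 0) :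
    (∀ a b c : A, Dnn2 S (mulDefectCoeff D ψ n) a b c - Dan2 S (mapDefectCoeff D ψ n) a b c = 0) ∧
    (∀ a b : A, Dna2 S (mulDefectCoeff D ψ n) a b - Daa2 S (mapDefectCoeff D ψ n) a b = 0) := by
  constructor
  · intro a b c
    have key := D.seriesDefect_eq_zero n (orbitSeries ψ a) (orbitSeries ψ b) (orbitSeries ψ c)
    simp only [seriesDefect, Pi.add_apply, Pi.sub_apply, seriesMul_orbit_eq D ψ,
      seriesMap_orbit_eq D ψ] at key
    simp only [seriesMul_orbit_sub_orbit_sub D h0 hn _ _ (fun i hi => hmul i hi _ _)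
        (fun i hi => hmap i hi _),
      seriesMul_orbit_sub_orbit_sub D h0 hn _ _ (fun i hi => hmap i hi _)
        (fun i hi => hmul i hi _ _),
      ← mulDefectCoeff_apply, ← mapDefectCoeff_apply] at key
    have hpl := congrArg (ψ n) (S.homPreLie a b c)
    simp only [map_sub] at hpl
    simp only [Dnn2, Dan2]
    linear_combination (norm := abel) key - hpl
  · intro a b
    have key := D.seriesMap_seriesMul n (orbitSeries ψ a) (orbitSeries ψ b)
    rw [seriesMul_orbit_eq, seriesMap_sub, Pi.sub_apply,
      seriesMap_of_vanish _ (fun i hi => hmul i hi _ _), seriesMap_orbit_eq, seriesMap_orbit_eq,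
      seriesMap_orbit_eq, seriesMul_orbit_sub_orbit_sub D h0 hn _ _ (fun i hi => hmap i hi _)
        (fun i hi => hmap i hi _), Pi.sub_apply, D.al_zero, ← mulDefectCoeff_apply,
      ← mapDefectCoeff_apply, ← mapDefectCoeff_apply, ← mapDefectCoeff_apply, orbitSeries,
      S.alpha_mult] at key
    simp only [Dna2, Daa2]
    linear_combination (norm := abel) -key

theorem mulDefect_update (D : FormalDef S) {ψ : ℕ → (A →ₗ[K] A)} (h0 : ∀ a, ψ 0 a = a)
    {n : ℕ} (hn : 0 < n) (φ : A →ₗ[K] A) (a b : A) :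
    mulDefect D (Function.update ψ n φ) a b n
      = mulDefect D (Function.update ψ n 0) a b n - Dnn1 S φ a b := by
  have hs : ∀ c : A, ∀ i < n, (Pi.single n c : ℕ → A) i = 0 :=
    fun c i hi => Pi.single_eq_of_ne (M := fun _ => A) hi.ne c
  simp only [mulDefect, orbitSeries_update ψ n φ, seriesMul_add_left, seriesMul_add_right,
    Pi.sub_apply, Pi.add_apply, seriesMul_of_vanish_left _ (hs _),
    seriesMul_of_vanish_right _ _ (hs _), D.nu_zero, Pi.single_eq_same, Dnn1]
  simp only [orbitSeries, Function.update_of_ne hn.ne, h0, Pi.single_eq_of_ne hn.ne, map_zero]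
  abel

theorem mapDefect_update (D : FormalDef S) (ψ : ℕ → (A →ₗ[K] A)) (n : ℕ) (φ : A →ₗ[K] A)
    (a : A) :
    mapDefect D (Function.update ψ n φ) a n
      = mapDefect D (Function.update ψ n 0) a n - Dna1 S φ a := by
  have hs : ∀ c : A, ∀ i < n, (Pi.single n c : ℕ → A) i = 0 :=
    fun c i hi => Pi.single_eq_of_ne (M := fun _ => A) hi.ne c
  simp only [mapDefect, orbitSeries_update ψ n φ, seriesMap_add, Pi.sub_apply, Pi.add_apply,
    seriesMap_of_vanish _ (hs _), D.al_zero, Pi.single_eq_same, Dna1]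
  abel

theorem mulDefect_congr (D : FormalDef S) {ψ ψ' : ℕ → (A →ₗ[K] A)} {n : ℕ}
    (h : ∀ i ≤ n, ψ i = ψ' i) (a b : A) : mulDefect D ψ a b n = mulDefect D ψ' a b n := by
  have ho : ∀ c : A, ∀ i ≤ n, orbitSeries ψ c i = orbitSeries ψ' c i :=
    fun c i hi => by rw [orbitSeries, orbitSeries, h i hi]
  rw [mulDefect, mulDefect, Pi.sub_apply, Pi.sub_apply, ho _ n le_rfl,
    seriesMul_congr _ (ho a) (ho b)]

theorem mapDefect_congr (D : FormalDef S) {ψ ψ' : ℕ → (A →ₗ[K] A)} {n : ℕ}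
    (h : ∀ i ≤ n, ψ i = ψ' i) (a : A) : mapDefect D ψ a n = mapDefect D ψ' a n := by
  have ho : ∀ c : A, ∀ i ≤ n, orbitSeries ψ c i = orbitSeries ψ' c i :=
    fun c i hi => by rw [orbitSeries, orbitSeries, h i hi]
  rw [mapDefect, mapDefect, Pi.sub_apply, Pi.sub_apply, ho _ n le_rfl,
    seriesMap_congr _ (ho a)]

/-- If second cohomology vanishes, a deformation receives a formal isomorphism from the
undeformed algebra. -/
theorem FormalDef.exists_defect_eq_zero
    (h2 : ∀ (ν' : A →ₗ[K] A →ₗ[K] A) (α' : A →ₗ[K] A),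
      (∀ a b c : A, Dnn2 S ν' a b c - Dan2 S α' a b c = 0) →
      (∀ a b : A, Dna2 S ν' a b - Daa2 S α' a b = 0) →
      ∃ φ : A →ₗ[K] A,
        (∀ a b : A, ν' a b = Dnn1 S φ a b) ∧ (∀ a : A, α' a = Dna1 S φ a))
    (D : FormalDef S) :
    ∃ ψ : ℕ → (A →ₗ[K] A), (∀ a, ψ 0 a = a) ∧ (∀ n a b, mulDefect D ψ a b n = 0) ∧
      (∀ n a, mapDefect D ψ a n = 0) := by
  suffices h : ∃ ψ : ℕ → (A →ₗ[K] A), ∀ n, (∀ a, ψ 0 a = a) ∧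
      (∀ a b, mulDefect D ψ a b n = 0) ∧ (∀ a, mapDefect D ψ a n = 0) by
    obtain ⟨ψ, hψ⟩ := h
    exact ⟨ψ, (hψ 0).1, fun n => (hψ n).2.1, fun n => (hψ n).2.2⟩
  refine exists_seq_of_step
    (fun n (ψ : ℕ → (A →ₗ[K] A)) => (∀ a, ψ 0 a = a) ∧ (∀ a b, mulDefect D ψ a b n = 0) ∧
      (∀ a, mapDefect D ψ a n = 0)) ?_ ?_
  · rintro n f g hfg ⟨h0, hmul, hmap⟩
    refine ⟨fun a => ?_, fun a b => ?_, fun a => ?_⟩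
    · rw [← hfg 0 (Nat.zero_le n), h0]
    · rw [← mulDefect_congr D hfg, hmul]
    · rw [← mapDefect_congr D hfg, hmap]
  · intro n f hf
    rcases Nat.eq_zero_or_pos n with rfl | hn
    · refine ⟨LinearMap.id, ?_, ?_, ?_⟩
      · simp
      · intro a b
        simp [mulDefect, seriesMul, orbitSeries, D.nu_zero]
      · intro a
        simp [mapDefect, seriesMap, orbitSeries, D.al_zero]
    · have h0 := (hf 0 hn).1
      have hagree : ∀ m < n, ∀ i ≤ m, f i = Function.update f n 0 i :=
        fun m hm i hi => (Function.update_of_ne (by omega) _ _).symm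
      obtain ⟨hc, hc'⟩ := defectCoeff_cocycle D (ψ := Function.update f n 0)
        (fun a => by rw [Function.update_of_ne hn.ne, h0]) hn
        (fun m hm a b => by rw [← mulDefect_congr D (hagree m hm), (hf m hm).2.1])
        (fun m hm a => by rw [← mapDefect_congr D (hagree m hm), (hf m hm).2.2])
      obtain ⟨φ, hφ, hφ'⟩ := h2 _ _ hc hc'
      refine ⟨φ, fun a => by rw [Function.update_of_ne hn.ne, h0], fun a b => ?_, fun a => ?_⟩
      · rw [mulDefect_update D h0 hn, ← hφ, mulDefectCoeff_apply, sub_self]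
      · rw [mapDefect_update, ← hφ', mapDefectCoeff_apply, sub_self]

/-- The trivial deformation. -/
def trivialDef (S : HomPreLieStr K A) : FormalDef S where
  nu := Pi.single 0 S.mul
  al := Pi.single 0 S.alpha
  nu_zero a b := by simp
  al_zero a := by simp
  deform n a b c := by
    rcases Nat.eq_zero_or_pos n with rfl | hn
    · have h := S.homPreLie a b c
      simp only [zero_add, range_one, sum_singleton, Nat.sub_zero, Pi.single_eq_same]
      linear_combination (norm := abel) h
    · refine Finset.sum_eq_zero fun i _ => Finset.sum_eq_zero fun j _ => ?_
      rcases Nat.eq_zero_or_pos i with rfl | hi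
      · rcases Nat.eq_zero_or_pos j with rfl | hj
        · simp [Pi.single_eq_of_ne hn.ne']
        · simp [Pi.single_eq_of_ne hj.ne']
      · simp [Pi.single_eq_of_ne hi.ne']
  deform_alpha n a b := by
    rcases Nat.eq_zero_or_pos n with rfl | hn
    · simp [S.alpha_mult]
    · rw [Finset.sum_eq_zero, Finset.sum_eq_zero]
      · intro i _
        rcases Nat.eq_zero_or_pos i with rfl | hi
        · simp [Pi.single_eq_of_ne hn.ne']
        · simp [Pi.single_eq_of_ne hi.ne']
      · refine fun i _ => Finset.sum_eq_zero fun j _ => ?_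
        rcases Nat.eq_zero_or_pos i with rfl | hi
        · rcases Nat.eq_zero_or_pos j with rfl | hj
          · simp [Pi.single_eq_of_ne hn.ne']
          · simp [Pi.single_eq_of_ne hj.ne']
        · simp [Pi.single_eq_of_ne hi.ne']

theorem sum_range_apply_of_vanish {B : Type*} [AddCommGroup B] [Module K B]
    (ψ : ℕ → (B →ₗ[K] B)) (x : ℕ → B) (hx : ∀ i, i ≠ 0 → x i = 0) (n : ℕ) :
    ∑ i ∈ Finset.range (n + 1), ψ i (x (n - i)) = ψ n (x 0) := by
  rw [Finset.sum_eq_single n]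
  · rw [Nat.sub_self]
  · intro i hi hne
    rw [Finset.mem_range] at hi
    rw [hx _ (by omega), map_zero]
  · simp

end Rigidity

/-- If the second α-type cohomology of a Hom-pre-Lie algebra (with regular
coefficients) vanishes — every 2-cocycle `(ν', α')` is a coboundary
`(∂̃_{νν}φ, ∂̃_{να}φ)` — then `A` is rigid: every formal deformation is
equivalent to the trivial deformation. -/
theorem rigidity_of_H2_vanishing (K A : Type) [Field K] [CharZero K]
    [AddCommGroup A] [Module K A] (S : HomPreLieStr K A)
    (h2 : ∀ (ν' : A →ₗ[K] A →ₗ[K] A) (α' : A →ₗ[K] A),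
      (∀ a b c : A, Dnn2 S ν' a b c - Dan2 S α' a b c = 0) →
      (∀ a b : A, Dna2 S ν' a b - Daa2 S α' a b = 0) →
      ∃ φ : A →ₗ[K] A,
        (∀ a b : A, ν' a b = Dnn1 S φ a b) ∧ (∀ a : A, α' a = Dna1 S φ a)) :
    ∀ D : FormalDef S, ∃ (D' : FormalDef S) (ψ : ℕ → (A →ₗ[K] A)),
      (∀ i, 1 ≤ i → (∀ a b : A, D'.nu i a b = 0) ∧ (∀ a : A, D'.al i a = 0)) ∧
      AreEquiv D D' ψ := by
  intro D
  obtain ⟨ψ, h0, hmul, hmap⟩ := D.exists_defect_eq_zero h2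
  have hnu : ∀ i, i ≠ 0 → ∀ a b, (trivialDef S).nu i a b = 0 := fun i hi a b => by
    simp [trivialDef, Pi.single_eq_of_ne hi]
  have hal : ∀ i, i ≠ 0 → ∀ a, (trivialDef S).al i a = 0 := fun i hi a => by
    simp [trivialDef, Pi.single_eq_of_ne hi]
  refine ⟨trivialDef S, ψ, fun i hi => ⟨hnu i (by omega), hal i (by omega)⟩, h0,
    fun n a b => ?_, fun n a => ?_⟩
  · rw [sum_range_apply_of_vanish ψ (fun i => (trivialDef S).nu i a b) (fun i hi => hnu i hi a b),
      FormalDef.nu_zero]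
    exact (sub_eq_zero.mp (hmul n a b)).trans (seriesMul_eq_range _ _ _ n)
  · rw [sum_range_apply_of_vanish ψ (fun i => (trivialDef S).al i a) (fun i hi => hal i hi a),
      FormalDef.al_zero]
    exact ((sub_eq_zero.mp (hmap n a)).trans (seriesMap_eq_range _ _ n)).symm
end

section
/- Let (A, ·, α) be a Hom-pre-Lie algebra over a field K of characteristic zero equipped with an action of a finite group G, and for each subgroup H ≤ G consider the α-type cochain complex of the sub-Hom-pre-Lie algebra A^H with coefficients in its regular representation. Suppose c = {(c^H_ν, c^H_α)}_{H≤G} is an invariant n-cochain family, i.e., for every g ∈ G and subgroups H, K ≤ G with g⁻¹Hg ⊆ K one has c^H_ν ∘ (ψ_g)^⊗n = ψ_g ∘ c^K_ν and c^H_α ∘ (ψ_g)^⊗(n−1) = ψ_g ∘ c^K_α (as maps defined on A^K, noting ψ_g maps A^K into A^H). Then the family of differentials {∂̃^H(c^H_ν, c^H_α)}_{H≤G} is an invariant (n+1)-cochain family; in particular the invariant cochains form a subcomplex. -/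
open Finset

/-- An action of a group `G` on a Hom-pre-Lie algebra `(A,·,α)` by linear
automorphisms preserving the product and commuting with `α`. -/
structure HPLAction {K A : Type} [Field K] [AddCommGroup A] [Module K A]
    (S : HomPreLieStr K A) (G : Type) [Group G] where
  psi : G →* (A ≃ₗ[K] A)
  psi_mul : ∀ (g : G) (a b : A), psi g (S.mul a b) = S.mul (psi g a) (psi g b)
  psi_alpha : ∀ (g : G) (a : A), S.alpha (psi g a) = psi g (S.alpha a)

/-- The `H`-fixed point set `A^H` of the action, for a subgroup `H ≤ G`. -/
def HPLAction.fx {K A : Type} [Field K] [AddCommGroup A] [Module K A]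
    {S : HomPreLieStr K A} {G : Type} [Group G] (act : HPLAction S G)
    (H : Subgroup G) : Set A :=
  {a : A | ∀ h ∈ H, act.psi h a = a}

section Naturality

/-- On tuples with entries in `B`, evaluating `f'` on their images under `φ` agrees with applying
`χ` to the value of `f`. -/
def IntertwinesOn {A A' V V' : Type} (B : Set A) (φ : A → A') (χ : V → V') {n : ℕ}
    (f : (Fin n → A) → V) (f' : (Fin n → A') → V') : Prop :=
  ∀ a : Fin n → A, (∀ i, a i ∈ B) → f' (fun i => φ (a i)) = χ (f a)

variable {A A' V V' : Type}

theorem IntertwinesOn.snoc {B : Set A} {φ : A → A'} {χ : V → V'} {n : ℕ}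
    {f : (Fin (n + 1) → A) → V} {f' : (Fin (n + 1) → A') → V'}
    (hf : IntertwinesOn B φ χ f f') {a : Fin n → A} {x : A} (ha : ∀ i, a i ∈ B) (hx : x ∈ B) :
    f' (Fin.snoc (fun i => φ (a i)) (φ x)) = χ (f (Fin.snoc a x)) := by
  rw [← hf _ (Fin.lastCases (by simpa using hx) (by simpa using ha))]
  congr 1
  ext i
  refine Fin.lastCases ?_ (fun i => ?_) i <;> simp

theorem IntertwinesOn.cons {B : Set A} {φ : A → A'} {χ : V → V'} {n : ℕ}
    {f : (Fin (n + 1) → A) → V} {f' : (Fin (n + 1) → A') → V'}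
    (hf : IntertwinesOn B φ χ f f') {x : A} {a : Fin n → A} (hx : x ∈ B) (ha : ∀ i, a i ∈ B) :
    f' (Fin.cons (φ x) (fun i => φ (a i))) = χ (f (Fin.cons x a)) := by
  rw [← hf _ (Fin.cases (by simpa using hx) (by simpa using ha))]
  congr 1
  ext i
  refine Fin.cases ?_ (fun i => ?_) i <;> simp

variable [AddCommGroup V] [AddCommGroup V']

theorem IntertwinesOn.sub {B : Set A} {φ : A → A'} {χ : V →+ V'} {n : ℕ}
    {f g : (Fin n → A) → V} {f' g' : (Fin n → A') → V'}
    (hf : IntertwinesOn B φ χ f f') (hg : IntertwinesOn B φ χ g g') :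
    IntertwinesOn B φ χ (f - g) (f' - g') := fun a ha => by
  simp only [Pi.sub_apply, map_sub, hf a ha, hg a ha]

variable [AddCommGroup A] [AddCommGroup A']
  {B : Set A} {φ : A →+ A'} {χ : V →+ V'}
  {mul : A → A → A} {mul' : A' → A' → A'} {alpha : A → A} {alpha' : A' → A'}
  {rho mu : A → V → V} {rho' mu' : A' → V' → V'}

theorem IntertwinesOn.dnn (hBsub : ∀ a ∈ B, ∀ b ∈ B, a - b ∈ B)
    (hBmul : ∀ a ∈ B, ∀ b ∈ B, mul a b ∈ B) (hBalpha : ∀ a ∈ B, alpha a ∈ B)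
    (hmul : ∀ a b, φ (mul a b) = mul' (φ a) (φ b)) (halpha : Function.Semiconj φ alpha alpha')
    (hrho : ∀ a v, χ (rho a v) = rho' (φ a) (χ v)) (hmu : ∀ a v, χ (mu a v) = mu' (φ a) (χ v))
    {n : ℕ} {f : (Fin (n + 1) → A) → V} {f' : (Fin (n + 1) → A') → V'}
    (hf : IntertwinesOn B φ χ f f') :
    IntertwinesOn B φ χ (dnn mul alpha rho mu n f) (dnn mul' alpha' rho' mu' n f') := by
  intro a ha
  simp only [_root_.dnn, map_add, map_sub, map_sum, map_zsmul, apply_ite χ, map_zero, hrho, hmu,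
    (halpha.iterate_right _).eq]
  congr! 6 with i _ i _ i _ i _ j _
  · exact hf _ fun _ => ha _
  · exact hf.snoc (fun _ => ha _) (ha _)
  · simp only [← hmul, ← halpha.eq]
    exact hf.snoc (fun _ => hBalpha _ (ha _)) (hBmul _ (ha _) _ (ha _))
  · simp only [← hmul, ← halpha.eq, ← map_sub]
    rw [hf.cons (hBsub _ (hBmul _ (ha _) _ (ha _)) _ (hBmul _ (ha _) _ (ha _)))
      fun _ => hBalpha _ (ha _)]

theorem IntertwinesOn.daa (hBsub : ∀ a ∈ B, ∀ b ∈ B, a - b ∈ B)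
    (hBmul : ∀ a ∈ B, ∀ b ∈ B, mul a b ∈ B) (hBalpha : ∀ a ∈ B, alpha a ∈ B)
    (hmul : ∀ a b, φ (mul a b) = mul' (φ a) (φ b)) (halpha : Function.Semiconj φ alpha alpha')
    (hrho : ∀ a v, χ (rho a v) = rho' (φ a) (χ v)) (hmu : ∀ a v, χ (mu a v) = mu' (φ a) (χ v))
    {p : ℕ} {g : (Fin (p + 1) → A) → V} {g' : (Fin (p + 1) → A') → V'}
    (hg : IntertwinesOn B φ χ g g') :
    IntertwinesOn B φ χ (daa mul alpha rho mu p g) (daa mul' alpha' rho' mu' p g') := by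
  intro a ha
  simp only [_root_.daa, map_add, map_sub, map_sum, map_zsmul, apply_ite χ, map_zero, hrho, hmu,
    (halpha.iterate_right _).eq]
  congr! 6 with i _ i _ i _ i _ j _
  · exact hg _ fun _ => ha _
  · exact hg.snoc (fun _ => ha _) (ha _)
  · simp only [← hmul, ← halpha.eq]
    exact hg.snoc (fun _ => hBalpha _ (ha _)) (hBmul _ (ha _) _ (ha _))
  · simp only [← hmul, ← halpha.eq, ← map_sub]
    rw [hg.cons (hBsub _ (hBmul _ (ha _) _ (ha _)) _ (hBmul _ (ha _) _ (ha _)))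
      fun _ => hBalpha _ (ha _)]

theorem IntertwinesOn.dna {beta : V → V} {beta' : V' → V'}
    (hBalpha : ∀ a ∈ B, alpha a ∈ B) (halpha : Function.Semiconj φ alpha alpha')
    (hbeta : Function.Semiconj χ beta beta')
    {n : ℕ} {f : (Fin n → A) → V} {f' : (Fin n → A') → V'} (hf : IntertwinesOn B φ χ f f') :
    IntertwinesOn B φ χ (dna alpha beta f) (dna alpha' beta' f') := by
  intro a ha
  simp only [_root_.dna, map_sub, hbeta.eq, ← halpha.eq, hf a ha,
    hf (fun i => alpha (a i)) fun i => hBalpha _ (ha i)]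

theorem IntertwinesOn.dan
    (hmul : ∀ a b, φ (mul a b) = mul' (φ a) (φ b)) (halpha : Function.Semiconj φ alpha alpha')
    (hrho : ∀ a v, χ (rho a v) = rho' (φ a) (χ v)) (hmu : ∀ a v, χ (mu a v) = mu' (φ a) (χ v))
    {m : ℕ} {g : (Fin (m + 1) → A) → V} {g' : (Fin (m + 1) → A') → V'}
    (hg : IntertwinesOn B φ χ g g') :
    IntertwinesOn B φ χ (dan mul alpha rho mu m g) (dan mul' alpha' rho' mu' m g') := by
  intro a ha
  simp only [_root_.dan, map_sub, map_sum, map_zsmul, apply_ite χ, map_zero, hrho, hmu, hmul,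
    (halpha.iterate_right _).eq]
  congr! 5 with i _ i _ j _
  · exact hg _ fun _ => ha _
  · rw [hg _ fun _ => ha _]

end Naturality

namespace HPLAction

variable {K A G : Type} [Field K] [AddCommGroup A] [Module K A] [Group G]
  {S : HomPreLieStr K A} (act : HPLAction S G) {H : Subgroup G}

theorem sub_mem_fx (a : A) (ha : a ∈ act.fx H) (b : A) (hb : b ∈ act.fx H) :
    a - b ∈ act.fx H := fun h hh => by
  rw [map_sub, ha h hh, hb h hh]

theorem mul_mem_fx (a : A) (ha : a ∈ act.fx H) (b : A) (hb : b ∈ act.fx H) :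
    S.mul a b ∈ act.fx H := fun h hh => by
  rw [act.psi_mul, ha h hh, hb h hh]

theorem alpha_mem_fx (a : A) (ha : a ∈ act.fx H) : S.alpha a ∈ act.fx H := fun h hh => by
  rw [← act.psi_alpha, ha h hh]

end HPLAction

/-- If `c = {(c^H_ν, c^H_α)}_{H ≤ G}` is an invariant family of `n`-cochains
(`n = m+2`, with `c^H_ν` of arity `n` and `c^H_α` of arity `n−1`, valued in the
fixed-point subalgebras and compatible with the maps `ψ_g` attached to
subconjugacy relations `g⁻¹Hg ⊆ K'`), then the family of α-type differentials
`∂̃^H(c^H_ν, c^H_α) = (∂̃_{νν}c^H_ν − ∂̃_{αν}c^H_α, ∂̃_{να}c^H_ν − ∂̃_{αα}c^H_α)`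
(regular coefficients) is an invariant family of `(n+1)`-cochains; in particular
the invariant cochains form a subcomplex. -/
theorem invariant_cochains_subcomplex (K A G : Type) [Field K] [CharZero K]
    [AddCommGroup A] [Module K A] [Group G] [Fintype G]
    (S : HomPreLieStr K A) (act : HPLAction S G) (m : ℕ)
    (cν : Subgroup G → MultilinearMap K (fun _ : Fin (m + 2) => A) A)
    (cα : Subgroup G → MultilinearMap K (fun _ : Fin (m + 1) => A) A)
    (hmapν : ∀ (H : Subgroup G) (a : Fin (m + 2) → A),
      (∀ i, a i ∈ act.fx H) → cν H a ∈ act.fx H)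
    (hmapα : ∀ (H : Subgroup G) (a : Fin (m + 1) → A),
      (∀ i, a i ∈ act.fx H) → cα H a ∈ act.fx H)
    (hinvν : ∀ (g : G) (H K' : Subgroup G), (∀ h ∈ H, g⁻¹ * h * g ∈ K') →
      ∀ a : Fin (m + 2) → A, (∀ i, a i ∈ act.fx K') →
        cν H (fun i => act.psi g (a i)) = act.psi g (cν K' a))
    (hinvα : ∀ (g : G) (H K' : Subgroup G), (∀ h ∈ H, g⁻¹ * h * g ∈ K') →
      ∀ a : Fin (m + 1) → A, (∀ i, a i ∈ act.fx K') →
        cα H (fun i => act.psi g (a i)) = act.psi g (cα K' a)) :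
    (∀ (g : G) (H K' : Subgroup G), (∀ h ∈ H, g⁻¹ * h * g ∈ K') →
      ∀ a : Fin (m + 3) → A, (∀ i, a i ∈ act.fx K') →
        (dnn (fun x y => S.mul x y) (⇑S.alpha)
            (fun x v => S.mul x v) (fun x v => S.mul v x) (m + 1) (⇑(cν H))
          - dan (fun x y => S.mul x y) (⇑S.alpha)
            (fun x v => S.mul x v) (fun x v => S.mul v x) m (⇑(cα H)))
          (fun i => act.psi g (a i))
        = act.psi g
            ((dnn (fun x y => S.mul x y) (⇑S.alpha)
                (fun x v => S.mul x v) (fun x v => S.mul v x) (m + 1) (⇑(cν K'))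
              - dan (fun x y => S.mul x y) (⇑S.alpha)
                (fun x v => S.mul x v) (fun x v => S.mul v x) m (⇑(cα K'))) a)) ∧
    (∀ (g : G) (H K' : Subgroup G), (∀ h ∈ H, g⁻¹ * h * g ∈ K') →
      ∀ a : Fin (m + 2) → A, (∀ i, a i ∈ act.fx K') →
        (dna (⇑S.alpha) (⇑S.alpha) (⇑(cν H))
          - daa (fun x y => S.mul x y) (⇑S.alpha)
            (fun x v => S.mul x v) (fun x v => S.mul v x) m (⇑(cα H)))
          (fun i => act.psi g (a i))
        = act.psi g
            ((dna (⇑S.alpha) (⇑S.alpha) (⇑(cν K'))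
              - daa (fun x y => S.mul x y) (⇑S.alpha)
                (fun x v => S.mul x v) (fun x v => S.mul v x) m (⇑(cα K'))) a)) := by
  have hα (g : G) : Function.Semiconj (act.psi g : A →+ A) S.alpha S.alpha :=
    fun a => (act.psi_alpha g a).symm
  have hcν (g : G) (H K' : Subgroup G) (hg : ∀ h ∈ H, g⁻¹ * h * g ∈ K') :
      IntertwinesOn (act.fx K') (act.psi g : A →+ A) (act.psi g : A →+ A) (cν K') (cν H) :=
    hinvν g H K' hg
  have hcα (g : G) (H K' : Subgroup G) (hg : ∀ h ∈ H, g⁻¹ * h * g ∈ K') :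
      IntertwinesOn (act.fx K') (act.psi g : A →+ A) (act.psi g : A →+ A) (cα K') (cα H) :=
    hinvα g H K' hg
  refine ⟨fun g H K' hg => ?_, fun g H K' hg => ?_⟩
  · exact ((hcν g H K' hg).dnn act.sub_mem_fx act.mul_mem_fx act.alpha_mem_fx (act.psi_mul g) (hα g)
      (act.psi_mul g) (fun a v => act.psi_mul g v a)).sub
      ((hcα g H K' hg).dan (act.psi_mul g) (hα g) (act.psi_mul g) (fun a v => act.psi_mul g v a))
  · exact ((hcν g H K' hg).dna act.alpha_mem_fx (hα g) (hα g)).sub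
      ((hcα g H K' hg).daa act.sub_mem_fx act.mul_mem_fx act.alpha_mem_fx (act.psi_mul g) (hα g)
        (act.psi_mul g) (fun a v => act.psi_mul g v a))
end

section
/- Let (A, ·, α) be a Hom-pre-Lie algebra over a field K of characteristic zero equipped with an action of a finite group G, and let {(ν^H_i, α^H_i)_{i≥0}}_{H≤G} be an equivariant formal deformation of A. Then the equivariant infinitesimal is an equivariant 2-cocycle: for every subgroup H ≤ G, ∂̃_{νν}ν^H₁ − ∂̃_{αν}α^H₁ = 0 and ∂̃_{να}ν^H₁ − ∂̃_{αα}α^H₁ = 0 on A^H (differentials of the α-type complex of A^H with regular coefficients), and the family {(ν^H₁, α^H₁)}_{H≤G} is invariant: ν^H₁(ψ_g(a), ψ_g(b)) = ψ_g(ν^K₁(a,b)) and α^H₁(ψ_g(a)) = ψ_g(α^K₁(a)) for all a, b ∈ A^K whenever g⁻¹Hg ⊆ K. -/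
open Finset

/-- An equivariant one-parameter formal deformation of a Hom-pre-Lie algebra `A`
equipped with an action of `G`: for each subgroup `H ≤ G`, sequences of bilinear
maps `ν^H_i` and linear maps `α^H_i` (encoded as maps on `A` preserving the
fixed-point subalgebra `A^H`), restricting to `·` and `α` in order zero,
satisfying the deformation equations on `A^H` in every order, and compatible
with the maps `ψ_g` attached to subconjugacy relations `g⁻¹Hg ⊆ K'`. -/
structure EquivFormalDef {K A : Type} [Field K] [AddCommGroup A] [Module K A]
    (S : HomPreLieStr K A) {G : Type} [Group G] (act : HPLAction S G) where
  nu : Subgroup G → ℕ → (A →ₗ[K] A →ₗ[K] A)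
  al : Subgroup G → ℕ → (A →ₗ[K] A)
  nu_zero : ∀ (H : Subgroup G) (a b : A), a ∈ act.fx H → b ∈ act.fx H →
    nu H 0 a b = S.mul a b
  al_zero : ∀ (H : Subgroup G) (a : A), a ∈ act.fx H → al H 0 a = S.alpha a
  maps_nu : ∀ (H : Subgroup G) (i : ℕ) (a b : A), a ∈ act.fx H → b ∈ act.fx H →
    nu H i a b ∈ act.fx H
  maps_al : ∀ (H : Subgroup G) (i : ℕ) (a : A), a ∈ act.fx H → al H i a ∈ act.fx H
  deform : ∀ (H : Subgroup G) (n : ℕ) (a b c : A),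
    a ∈ act.fx H → b ∈ act.fx H → c ∈ act.fx H →
    (∑ i ∈ Finset.range (n + 1), ∑ j ∈ Finset.range (n + 1 - i),
      (nu H i (nu H j a b) (al H (n - i - j) c)
        - nu H i (al H j a) (nu H (n - i - j) b c)
        - nu H i (nu H j b a) (al H (n - i - j) c)
        + nu H i (al H j b) (nu H (n - i - j) a c))) = 0
  deform_alpha : ∀ (H : Subgroup G) (n : ℕ) (a b : A),
    a ∈ act.fx H → b ∈ act.fx H →
    (∑ i ∈ Finset.range (n + 1), ∑ j ∈ Finset.range (n + 1 - i),
      nu H i (al H j a) (al H (n - i - j) b))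
      = ∑ i ∈ Finset.range (n + 1), al H i (nu H (n - i) a b)
  equivar_nu : ∀ (g : G) (H K' : Subgroup G), (∀ h ∈ H, g⁻¹ * h * g ∈ K') →
    ∀ (i : ℕ) (a b : A), a ∈ act.fx K' → b ∈ act.fx K' →
      nu H i (act.psi g a) (act.psi g b) = act.psi g (nu K' i a b)
  equivar_al : ∀ (g : G) (H K' : Subgroup G), (∀ h ∈ H, g⁻¹ * h * g ∈ K') →
    ∀ (i : ℕ) (a : A), a ∈ act.fx K' →
      al H i (act.psi g a) = act.psi g (al K' i a)

/-- An equivariant deformation of order `n`. -/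
def IsEquivDefOrder {K A : Type} [Field K] [AddCommGroup A] [Module K A]
    (S : HomPreLieStr K A) {G : Type} [Group G] (act : HPLAction S G)
    (nu : Subgroup G → ℕ → (A →ₗ[K] A →ₗ[K] A))
    (al : Subgroup G → ℕ → (A →ₗ[K] A)) (n : ℕ) : Prop :=
  (∀ (H : Subgroup G) (a b : A), a ∈ act.fx H → b ∈ act.fx H →
    nu H 0 a b = S.mul a b) ∧
  (∀ (H : Subgroup G) (a : A), a ∈ act.fx H → al H 0 a = S.alpha a) ∧
  (∀ (H : Subgroup G) (i : ℕ) (a b : A), a ∈ act.fx H → b ∈ act.fx H →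
    nu H i a b ∈ act.fx H) ∧
  (∀ (H : Subgroup G) (i : ℕ) (a : A), a ∈ act.fx H → al H i a ∈ act.fx H) ∧
  (∀ (H : Subgroup G), ∀ m ≤ n, ∀ a b c : A,
    a ∈ act.fx H → b ∈ act.fx H → c ∈ act.fx H →
    (∑ i ∈ Finset.range (m + 1), ∑ j ∈ Finset.range (m + 1 - i),
      (nu H i (nu H j a b) (al H (m - i - j) c)
        - nu H i (al H j a) (nu H (m - i - j) b c)
        - nu H i (nu H j b a) (al H (m - i - j) c)
        + nu H i (al H j b) (nu H (m - i - j) a c))) = 0) ∧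
  (∀ (H : Subgroup G), ∀ m ≤ n, ∀ a b : A, a ∈ act.fx H → b ∈ act.fx H →
    (∑ i ∈ Finset.range (m + 1), ∑ j ∈ Finset.range (m + 1 - i),
      nu H i (al H j a) (al H (m - i - j) b))
      = ∑ i ∈ Finset.range (m + 1), al H i (nu H (m - i) a b)) ∧
  (∀ (g : G) (H K' : Subgroup G), (∀ h ∈ H, g⁻¹ * h * g ∈ K') →
    ∀ i ≤ n, ∀ a b : A, a ∈ act.fx K' → b ∈ act.fx K' →
      nu H i (act.psi g a) (act.psi g b) = act.psi g (nu K' i a b)) ∧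
  (∀ (g : G) (H K' : Subgroup G), (∀ h ∈ H, g⁻¹ * h * g ∈ K') →
    ∀ i ≤ n, ∀ a : A, a ∈ act.fx K' →
      al H i (act.psi g a) = act.psi g (al K' i a))

/-- Equivalence of two equivariant formal deformations via a family of formal
isomorphisms `Ψ^H_t = Σ ψ^H_i t^i` with `ψ^H₀ = id` on `A^H`. -/
def EquivAreEquiv {K A : Type} [Field K] [AddCommGroup A] [Module K A]
    {S : HomPreLieStr K A} {G : Type} [Group G] {act : HPLAction S G}
    (D D' : EquivFormalDef S act)
    (Ψ : Subgroup G → ℕ → (A →ₗ[K] A)) : Prop :=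
  (∀ (H : Subgroup G) (a : A), a ∈ act.fx H → Ψ H 0 a = a) ∧
  (∀ (H : Subgroup G) (n : ℕ) (a b : A), a ∈ act.fx H → b ∈ act.fx H →
    (∑ i ∈ Finset.range (n + 1), Ψ H i (D'.nu H (n - i) a b))
      = ∑ i ∈ Finset.range (n + 1), ∑ j ∈ Finset.range (n + 1 - i),
          D.nu H i (Ψ H j a) (Ψ H (n - i - j) b)) ∧
  (∀ (H : Subgroup G) (n : ℕ) (a : A), a ∈ act.fx H →
    (∑ i ∈ Finset.range (n + 1), D.al H i (Ψ H (n - i) a))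
      = ∑ i ∈ Finset.range (n + 1), Ψ H i (D'.al H (n - i) a))

section FixedPoints

variable {K A G : Type} [Field K] [AddCommGroup A] [Module K A] [Group G]
  {S : HomPreLieStr K A} {act : HPLAction S G} {H : Subgroup G} {a b : A}

theorem HPLAction.mul_mem_fx_s15 (ha : a ∈ act.fx H) (hb : b ∈ act.fx H) :
    S.mul a b ∈ act.fx H := fun h hh => by
  rw [act.psi_mul, ha h hh, hb h hh]

theorem HPLAction.alpha_mem_fx_s15 (ha : a ∈ act.fx H) : S.alpha a ∈ act.fx H := fun h hh => by
  rw [← act.psi_alpha, ha h hh]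

end FixedPoints

/-- The equivariant infinitesimal `{(ν^H₁, α^H₁)}_{H ≤ G}` of an equivariant
formal deformation is an equivariant 2-cocycle: on each `A^H` it satisfies the
α-type 2-cocycle equations (regular coefficients), and the family is invariant
under the maps `ψ_g` attached to subconjugacy relations. -/
theorem equivariant_infinitesimal_is_cocycle (K A G : Type) [Field K] [CharZero K]
    [AddCommGroup A] [Module K A] [Group G] [Fintype G]
    (S : HomPreLieStr K A) (act : HPLAction S G) (D : EquivFormalDef S act) :
    (∀ (H : Subgroup G) (a b c : A),
      a ∈ act.fx H → b ∈ act.fx H → c ∈ act.fx H →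
        Dnn2 S (D.nu H 1) a b c - Dan2 S (D.al H 1) a b c = 0) ∧
    (∀ (H : Subgroup G) (a b : A), a ∈ act.fx H → b ∈ act.fx H →
        Dna2 S (D.nu H 1) a b - Daa2 S (D.al H 1) a b = 0) ∧
    (∀ (g : G) (H K' : Subgroup G), (∀ h ∈ H, g⁻¹ * h * g ∈ K') →
      ∀ a b : A, a ∈ act.fx K' → b ∈ act.fx K' →
        D.nu H 1 (act.psi g a) (act.psi g b) = act.psi g (D.nu K' 1 a b)) ∧
    (∀ (g : G) (H K' : Subgroup G), (∀ h ∈ H, g⁻¹ * h * g ∈ K') →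
      ∀ a : A, a ∈ act.fx K' →
        D.al H 1 (act.psi g a) = act.psi g (D.al K' 1 a)) := by
  refine ⟨fun H a b c ha hb hc => ?_, fun H a b ha hb => ?_,
    fun g H K' h => D.equivar_nu g H K' h 1, fun g H K' h => D.equivar_al g H K' h 1⟩
  · have e := D.deform H 1 a b c ha hb hc
    simp only [sum_range_succ, sum_range_zero, Nat.reduceAdd, Nat.reduceSub, zero_add,
      D.al_zero H _ ha, D.al_zero H _ hb, D.al_zero H _ hc,
      D.nu_zero H _ _ ha hb, D.nu_zero H _ _ hb ha, D.nu_zero H _ _ hb hc,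
      D.nu_zero H _ _ ha hc,
      D.nu_zero H _ _ (D.maps_nu H 1 _ _ ha hb) (act.alpha_mem_fx_s15 hc),
      D.nu_zero H _ _ (D.maps_nu H 1 _ _ hb ha) (act.alpha_mem_fx_s15 hc),
      D.nu_zero H _ _ (act.alpha_mem_fx_s15 ha) (D.maps_nu H 1 _ _ hb hc),
      D.nu_zero H _ _ (act.alpha_mem_fx_s15 hb) (D.maps_nu H 1 _ _ ha hc),
      D.nu_zero H _ _ (act.mul_mem_fx_s15 ha hb) (D.maps_al H 1 _ hc),
      D.nu_zero H _ _ (act.mul_mem_fx_s15 hb ha) (D.maps_al H 1 _ hc),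
      D.nu_zero H _ _ (D.maps_al H 1 _ ha) (act.mul_mem_fx_s15 hb hc),
      D.nu_zero H _ _ (D.maps_al H 1 _ hb) (act.mul_mem_fx_s15 ha hc)] at e
    rw [← neg_eq_zero, ← e, Dnn2, Dan2]
    abel
  · have e := D.deform_alpha H 1 a b ha hb
    simp only [sum_range_succ, sum_range_zero, Nat.reduceAdd, Nat.reduceSub, zero_add,
      D.al_zero H _ ha, D.al_zero H _ hb, D.nu_zero H _ _ ha hb,
      D.al_zero H _ (D.maps_nu H 1 _ _ ha hb),
      D.nu_zero H _ _ (act.alpha_mem_fx_s15 ha) (D.maps_al H 1 _ hb),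
      D.nu_zero H _ _ (D.maps_al H 1 _ ha) (act.alpha_mem_fx_s15 hb)] at e
    rw [Dna2, Daa2, eq_sub_of_add_eq e.symm]
    abel
end

section
/- Let (A, ·, α) be a Hom-pre-Lie algebra over a field K of characteristic zero equipped with an action of a finite group G, and let {(ν^H_i, α^H_i)_{0≤i≤n}}_{H≤G} be an equivariant deformation of A of order n. Then it extends to an equivariant deformation of order n+1 (i.e., for each H ≤ G there exist bilinear ν^H_{n+1} and linear α^H_{n+1}, forming an invariant family, such that the extended data is an equivariant order-(n+1) deformation) if and only if the equivariant obstruction {(O^{n,H}_ν, O^{n,H}_α)}_{H≤G} is an equivariant 2-coboundary: there exists an invariant family of pairs (ν'^H, α'^H) with O^{n,H}_ν = ∂̃_{νν}ν'^H − ∂̃_{αν}α'^H and O^{n,H}_α = ∂̃_{να}ν'^H − ∂̃_{αα}α'^H for every H ≤ G. -/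
open Finset

section Reindexing

variable {M : Type*} [AddCommGroup M]

/-- The part of `∑_{i+j+k=n+1} f i j k` in which some index equals `n + 1` consists of three
corner terms. -/
theorem sum_triple_eq_sum_le_add_corners (f : ℕ → ℕ → ℕ → M) (n : ℕ) :
    (∑ i ∈ range (n + 1 + 1), ∑ j ∈ range (n + 1 + 1 - i), f i j (n + 1 - i - j))
      = (∑ i ∈ range (n + 1), ∑ j ∈ range (n + 1),
          if i + j ≤ n + 1 ∧ n + 1 - i - j ≤ n then f i j (n + 1 - i - j) else 0)
        + (f (n + 1) 0 0 + f 0 (n + 1) 0 + f 0 0 (n + 1)) := by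
  have corner : ∀ g : ℕ → M, ∑ j ∈ range (n + 1), g j
      = (∑ j ∈ range (n + 1), if j = 0 then 0 else g j) + g 0 := by
    intro g
    rw [sum_range_succ', sum_range_succ' (n := n)]
    simp
  have inner_zero : ∑ j ∈ range (n + 1 + 1), f 0 j (n + 1 - 0 - j)
      = (∑ j ∈ range (n + 1),
          if 0 + j ≤ n + 1 ∧ n + 1 - 0 - j ≤ n then f 0 j (n + 1 - 0 - j) else 0)
        + f 0 0 (n + 1) + f 0 (n + 1) 0 := by
    rw [sum_range_succ, corner]
    simp only [Nat.sub_zero, Nat.sub_self]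
    congr 2
    refine sum_congr rfl fun j hj => ?_
    have := mem_range.1 hj
    by_cases h0 : j = 0
    · rw [if_pos h0, if_neg (by omega)]
    · rw [if_neg h0, if_pos (by omega)]
  have inner_succ : ∀ i ∈ range n,
      ∑ j ∈ range (n + 1 + 1 - (i + 1)), f (i + 1) j (n + 1 - (i + 1) - j)
        = ∑ j ∈ range (n + 1), if (i + 1) + j ≤ n + 1 ∧ n + 1 - (i + 1) - j ≤ n then
          f (i + 1) j (n + 1 - (i + 1) - j) else 0 := by
    intro i hi
    have := mem_range.1 hi
    rw [← sum_filter]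
    refine sum_congr ?_ fun _ _ => rfl
    ext j
    simp only [mem_range, mem_filter]
    omega
  rw [sum_range_succ, sum_range_succ', sum_congr rfl inner_succ, sum_range_succ' (n := n)]
  rw [Nat.sub_zero (n + 1 + 1), inner_zero]
  have hone : n + 1 + 1 - (n + 1) = 1 := by omega
  rw [hone, sum_range_one]
  simp only [Nat.sub_self]
  abel

theorem sum_triple_swap (f : ℕ → ℕ → ℕ → M) (m : ℕ) :
    (∑ i ∈ range (m + 1), ∑ j ∈ range (m + 1 - i), f i j (m - i - j))
      = ∑ i ∈ range (m + 1), ∑ j ∈ range (m + 1 - i), f i (m - i - j) j := by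
  refine sum_congr rfl fun i hi => ?_
  have := mem_range.1 hi
  rw [← sum_range_reflect]
  refine sum_congr rfl fun j hj => ?_
  have := mem_range.1 hj
  congr 1 <;> omega

end Reindexing

section Extension

variable {K A : Type} [Field K] [AddCommGroup A] [Module K A]

/-- The associator sum in order `n + 1` is the obstruction plus the terms of index `n + 1`. -/
theorem associator_sum_succ_eq_obsNu_add (nu : ℕ → (A →ₗ[K] A →ₗ[K] A)) (al : ℕ → (A →ₗ[K] A))
    (n : ℕ) (a b c : A) :
    (∑ i ∈ range (n + 1 + 1), ∑ j ∈ range (n + 1 + 1 - i),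
      (nu i (nu j a b) (al (n + 1 - i - j) c) - nu i (al j a) (nu (n + 1 - i - j) b c)
        - nu i (nu j b a) (al (n + 1 - i - j) c) + nu i (al j b) (nu (n + 1 - i - j) a c)))
      = obsNu nu al n a b c
        + ((nu (n + 1) (nu 0 a b) (al 0 c) - nu (n + 1) (al 0 a) (nu 0 b c)
            - nu (n + 1) (nu 0 b a) (al 0 c) + nu (n + 1) (al 0 b) (nu 0 a c))
          + (nu 0 (nu (n + 1) a b) (al 0 c) - nu 0 (al 0 a) (nu (n + 1) b c)
            - nu 0 (nu (n + 1) b a) (al 0 c) + nu 0 (al 0 b) (nu (n + 1) a c))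
          + (nu 0 (nu 0 a b) (al (n + 1) c) - nu 0 (al (n + 1) a) (nu 0 b c)
            - nu 0 (nu 0 b a) (al (n + 1) c) + nu 0 (al (n + 1) b) (nu 0 a c))) := by
  have split := sum_triple_eq_sum_le_add_corners
    (fun i j k => nu i (nu j a b) (al k c) - nu i (al k a) (nu j b c)
        - nu i (nu j b a) (al k c) + nu i (al k b) (nu j a c)) n
  have swap : ∀ x y z : A,
      (∑ i ∈ range (n + 1 + 1), ∑ j ∈ range (n + 1 + 1 - i),
        nu i (al j x) (nu (n + 1 - i - j) y z))
      = ∑ i ∈ range (n + 1 + 1), ∑ j ∈ range (n + 1 + 1 - i),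
        nu i (al (n + 1 - i - j) x) (nu j y z) := fun x y z =>
    sum_triple_swap (fun i j k => nu i (al j x) (nu k y z)) (n + 1)
  refine Eq.trans ?_ split
  simp only [sum_add_distrib, sum_sub_distrib, swap]

/-- The multiplicativity defect in order `n + 1` is the obstruction plus the terms of index
`n + 1`. -/
theorem multiplicativity_sum_succ_eq_obsAl_add (nu : ℕ → (A →ₗ[K] A →ₗ[K] A))
    (al : ℕ → (A →ₗ[K] A)) (n : ℕ) (a b : A) :
    (∑ i ∈ range (n + 1 + 1), ∑ j ∈ range (n + 1 + 1 - i),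
      nu i (al j a) (al (n + 1 - i - j) b))
      - ∑ i ∈ range (n + 1 + 1), al i (nu (n + 1 - i) a b)
      = obsAl nu al n a b
        + (nu (n + 1) (al 0 a) (al 0 b) + nu 0 (al (n + 1) a) (al 0 b)
          + nu 0 (al 0 a) (al (n + 1) b)
          - al (n + 1) (nu 0 a b) - al 0 (nu (n + 1) a b)) := by
  have middle : ∑ i ∈ Icc 1 n, al i (nu (n + 1 - i) a b)
      = ∑ i ∈ range n, al (i + 1) (nu (n + 1 - (i + 1)) a b) := by
    rw [← Finset.Ico_add_one_right_eq_Icc, sum_Ico_eq_sum_range]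
    simp [add_comm]
  rw [sum_triple_eq_sum_le_add_corners (fun i j k => nu i (al j a) (al k b)) n, obsAl, middle,
    sum_range_succ _ (n + 1),
    sum_range_succ' (fun i => al i (nu (n + 1 - i) a b)) n]
  simp only [Nat.sub_self, Nat.sub_zero]
  abel

variable {S : HomPreLieStr K A} {nu : ℕ → (A →ₗ[K] A →ₗ[K] A)} {al : ℕ → (A →ₗ[K] A)}
  {X : Set A}

theorem associator_sum_update (hnu : ∀ a b : A, a ∈ X → b ∈ X → nu 0 a b = S.mul a b)
    (hal : ∀ a : A, a ∈ X → al 0 a = S.alpha a)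
    (mnu : ∀ a b : A, a ∈ X → b ∈ X → nu 0 a b ∈ X) (mal : ∀ a : A, a ∈ X → al 0 a ∈ X)
    {nu1 : A →ₗ[K] A →ₗ[K] A} {al1 : A →ₗ[K] A}
    (mnu1 : ∀ a b : A, a ∈ X → b ∈ X → nu1 a b ∈ X) (mal1 : ∀ a : A, a ∈ X → al1 a ∈ X)
    {nu' : ℕ → (A →ₗ[K] A →ₗ[K] A)} {al' : ℕ → (A →ₗ[K] A)} {n : ℕ}
    (hnu' : nu' = Function.update nu (n + 1) nu1) (hal' : al' = Function.update al (n + 1) al1)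
    {a b c : A} (ha : a ∈ X) (hb : b ∈ X) (hc : c ∈ X) :
    (∑ i ∈ range (n + 1 + 1), ∑ j ∈ range (n + 1 + 1 - i),
      (nu' i (nu' j a b) (al' (n + 1 - i - j) c) - nu' i (al' j a) (nu' (n + 1 - i - j) b c)
        - nu' i (nu' j b a) (al' (n + 1 - i - j) c) + nu' i (al' j b) (nu' (n + 1 - i - j) a c)))
      = obsNu nu al n a b c - (Dnn2 S nu1 a b c - Dan2 S al1 a b c) := by
  have h0 : (0 : ℕ) ≠ n + 1 := by omega
  rw [associator_sum_succ_eq_obsNu_add]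
  subst hnu' hal'
  rw [obsNu_update]
  simp only [Function.update_self, Function.update_of_ne h0]
  have smul : ∀ a b : A, a ∈ X → b ∈ X → S.mul a b ∈ X := fun a b ha hb =>
    hnu a b ha hb ▸ mnu a b ha hb
  have salpha : ∀ a : A, a ∈ X → S.alpha a ∈ X := fun a ha => hal a ha ▸ mal a ha
  simp only [hnu, hal, ha, hb, hc, smul, salpha, mnu1, mal1, Dnn2, Dan2]
  abel

theorem multiplicativity_sum_update
    (hnu : ∀ a b : A, a ∈ X → b ∈ X → nu 0 a b = S.mul a b)
    (hal : ∀ a : A, a ∈ X → al 0 a = S.alpha a) (mal : ∀ a : A, a ∈ X → al 0 a ∈ X)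
    {nu1 : A →ₗ[K] A →ₗ[K] A} {al1 : A →ₗ[K] A}
    (mnu1 : ∀ a b : A, a ∈ X → b ∈ X → nu1 a b ∈ X) (mal1 : ∀ a : A, a ∈ X → al1 a ∈ X)
    {nu' : ℕ → (A →ₗ[K] A →ₗ[K] A)} {al' : ℕ → (A →ₗ[K] A)} {n : ℕ}
    (hnu' : nu' = Function.update nu (n + 1) nu1) (hal' : al' = Function.update al (n + 1) al1)
    {a b : A} (ha : a ∈ X) (hb : b ∈ X) :
    (∑ i ∈ range (n + 1 + 1), ∑ j ∈ range (n + 1 + 1 - i),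
      nu' i (al' j a) (al' (n + 1 - i - j) b))
      - ∑ i ∈ range (n + 1 + 1), al' i (nu' (n + 1 - i) a b)
      = obsAl nu al n a b - (Dna2 S nu1 a b - Daa2 S al1 a b) := by
  have h0 : (0 : ℕ) ≠ n + 1 := by omega
  rw [multiplicativity_sum_succ_eq_obsAl_add]
  subst hnu' hal'
  rw [obsAl_update]
  simp only [Function.update_self, Function.update_of_ne h0]
  have salpha : ∀ a : A, a ∈ X → S.alpha a ∈ X := fun a ha => hal a ha ▸ mal a ha
  simp only [hnu, hal, ha, hb, salpha, mnu1, mal1, Dna2, Daa2]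
  abel

end Extension

/-- An equivariant order-`n` deformation extends to an equivariant order-`(n+1)`
deformation if and only if its equivariant obstruction
`{(O^{n,H}_ν, O^{n,H}_α)}_{H ≤ G}` is an equivariant 2-coboundary: there is an
invariant family of 2-cochains `(ν'^H, α'^H)` (valued in the fixed-point
subalgebras) with `O^{n,H}_ν = ∂̃_{νν}ν'^H − ∂̃_{αν}α'^H` and
`O^{n,H}_α = ∂̃_{να}ν'^H − ∂̃_{αα}α'^H` on each `A^H`. -/
theorem equivariant_extendable_iff_coboundary (K A G : Type) [Field K] [CharZero K]
    [AddCommGroup A] [Module K A] [Group G] [Fintype G]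
    (S : HomPreLieStr K A) (act : HPLAction S G)
    (nu : Subgroup G → ℕ → (A →ₗ[K] A →ₗ[K] A))
    (al : Subgroup G → ℕ → (A →ₗ[K] A)) (n : ℕ)
    (h : IsEquivDefOrder S act nu al n) :
    (∃ (nu1 : Subgroup G → (A →ₗ[K] A →ₗ[K] A)) (al1 : Subgroup G → (A →ₗ[K] A)),
        IsEquivDefOrder S act
          (fun H => Function.update (nu H) (n + 1) (nu1 H))
          (fun H => Function.update (al H) (n + 1) (al1 H)) (n + 1))
    ↔
    (∃ (ν' : Subgroup G → (A →ₗ[K] A →ₗ[K] A)) (α' : Subgroup G → (A →ₗ[K] A)),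
        (∀ (H : Subgroup G) (a b : A), a ∈ act.fx H → b ∈ act.fx H →
          ν' H a b ∈ act.fx H) ∧
        (∀ (H : Subgroup G) (a : A), a ∈ act.fx H → α' H a ∈ act.fx H) ∧
        (∀ (g : G) (H K' : Subgroup G), (∀ h ∈ H, g⁻¹ * h * g ∈ K') →
          ∀ a b : A, a ∈ act.fx K' → b ∈ act.fx K' →
            ν' H (act.psi g a) (act.psi g b) = act.psi g (ν' K' a b)) ∧
        (∀ (g : G) (H K' : Subgroup G), (∀ h ∈ H, g⁻¹ * h * g ∈ K') →
          ∀ a : A, a ∈ act.fx K' →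
            α' H (act.psi g a) = act.psi g (α' K' a)) ∧
        (∀ (H : Subgroup G) (a b c : A),
          a ∈ act.fx H → b ∈ act.fx H → c ∈ act.fx H →
            obsNu (nu H) (al H) n a b c = Dnn2 S (ν' H) a b c - Dan2 S (α' H) a b c) ∧
        (∀ (H : Subgroup G) (a b : A), a ∈ act.fx H → b ∈ act.fx H →
            obsAl (nu H) (al H) n a b = Dna2 S (ν' H) a b - Daa2 S (α' H) a b)) := by
  obtain ⟨hnu, hal, mnu, mal, hdef, hmult, enu, eal⟩ := h
  constructor
  · rintro ⟨nu1, al1, -, -, mnu1, mal1, hdef1, hmult1, enu1, eal1⟩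
    have mnu1 : ∀ (H : Subgroup G) (a b : A), a ∈ act.fx H → b ∈ act.fx H →
        nu1 H a b ∈ act.fx H := fun H a b ha hb => by
      simpa using mnu1 H (n + 1) a b ha hb
    have mal1 : ∀ (H : Subgroup G) (a : A), a ∈ act.fx H → al1 H a ∈ act.fx H :=
      fun H a ha => by simpa using mal1 H (n + 1) a ha
    refine ⟨nu1, al1, mnu1, mal1, fun g H K' hg a b ha hb => ?_, fun g H K' hg a ha => ?_,
      fun H a b c ha hb hc => ?_, fun H a b ha hb => ?_⟩
    · simpa using enu1 g H K' hg (n + 1) le_rfl a b ha hb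
    · simpa using eal1 g H K' hg (n + 1) le_rfl a ha
    · exact sub_eq_zero.1 ((associator_sum_update (hnu H) (hal H) (mnu H 0) (mal H 0) (mnu1 H)
        (mal1 H) rfl rfl ha hb hc).symm.trans (hdef1 H (n + 1) le_rfl a b c ha hb hc))
    · exact sub_eq_zero.1 ((multiplicativity_sum_update (hnu H) (hal H) (mal H 0) (mnu1 H)
        (mal1 H) rfl rfl ha hb).symm.trans
          (sub_eq_zero.2 (hmult1 H (n + 1) le_rfl a b ha hb)))
  · rintro ⟨nu1, al1, mnu1, mal1, enu1, eal1, obs_nu, obs_al⟩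
    have h0 : (0 : ℕ) ≠ n + 1 := by omega
    refine ⟨nu1, al1, fun H a b ha hb => ?_, fun H a ha => ?_, fun H i a b ha hb => ?_,
      fun H i a ha => ?_, fun H m hm a b c ha hb hc => ?_, fun H m hm a b ha hb => ?_,
      fun g H K' hg i hi a b ha hb => ?_, fun g H K' hg i hi a ha => ?_⟩
    · simpa [Function.update_of_ne h0] using hnu H a b ha hb
    · simpa [Function.update_of_ne h0] using hal H a ha
    · rcases eq_or_ne i (n + 1) with rfl | hi
      · simpa using mnu1 H a b ha hb
      · simpa [Function.update_of_ne hi] using mnu H i a b ha hb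
    · rcases eq_or_ne i (n + 1) with rfl | hi
      · simpa using mal1 H a ha
      · simpa [Function.update_of_ne hi] using mal H i a ha
    · rcases Nat.le_succ_iff.1 hm with hm | rfl
      · rw [← hdef H m hm a b c ha hb hc]
        refine sum_congr rfl fun i hi => sum_congr rfl fun j hj => ?_
        have := mem_range.1 hi
        have := mem_range.1 hj
        simp only [Function.update_of_ne (by omega : i ≠ n + 1),
          Function.update_of_ne (by omega : j ≠ n + 1),
          Function.update_of_ne (by omega : m - i - j ≠ n + 1)]
      · exact (associator_sum_update (hnu H) (hal H) (mnu H 0) (mal H 0) (mnu1 H)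
          (mal1 H) rfl rfl ha hb hc).trans (sub_eq_zero.2 (obs_nu H a b c ha hb hc))
    · rcases Nat.le_succ_iff.1 hm with hm | rfl
      · refine Eq.trans ?_ ((hmult H m hm a b ha hb).trans ?_)
        · refine sum_congr rfl fun i hi => sum_congr rfl fun j hj => ?_
          have := mem_range.1 hi
          have := mem_range.1 hj
          simp only [Function.update_of_ne (by omega : i ≠ n + 1),
            Function.update_of_ne (by omega : j ≠ n + 1),
            Function.update_of_ne (by omega : m - i - j ≠ n + 1)]
        · refine sum_congr rfl fun i hi => ?_
          have := mem_range.1 hi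
          simp only [Function.update_of_ne (by omega : i ≠ n + 1),
            Function.update_of_ne (by omega : m - i ≠ n + 1)]
      · exact sub_eq_zero.1 ((multiplicativity_sum_update (hnu H) (hal H) (mal H 0) (mnu1 H)
          (mal1 H) rfl rfl ha hb).trans (sub_eq_zero.2 (obs_al H a b ha hb)))
    · rcases Nat.le_succ_iff.1 hi with hi | rfl
      · simpa [Function.update_of_ne (by omega : i ≠ n + 1)] using
          enu g H K' hg i hi a b ha hb
      · simpa using enu1 g H K' hg a b ha hb
    · rcases Nat.le_succ_iff.1 hi with hi | rfl
      · simpa [Function.update_of_ne (by omega : i ≠ n + 1)] using eal g H K' hg i hi a ha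
      · simpa using eal1 g H K' hg a ha
end
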